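/- Let γ > 1 and suppose T satisfies the Functional Correlation Bound with rate n^{−γ} for η-Hölder observables. Then there exists a constant C > 0 with the following property: for all bounded η-Hölder v, w : M → ℝ with ∫_M v dμ = ∫_M w dμ = 0, every D > 0, every integer k ≥ 1, and every integer n ≥ 2k such that ‖𝕊_{v,w}(m)‖_{L^{γ}(μ)} ≤ D m ‖v‖_η ‖w‖_η holds for all integers 1 ≤ m < n, one has ‖𝕊_{v,w}(n)‖_{L^{γ}(μ)}^{γ} ≤ C (k^{γ} + (k^{1−γ} + k^{−γ/2}) D^{γ}) (n ‖v‖_η ‖w‖_η)^{γ}. -/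

import Mathlib

open MeasureTheory Function

/-- `T` satisfies the Functional Correlation Bound with rate `n ^ (-γ)` for `η`-Hölder
observables: there is a constant `C₀ > 0` such that for all `0 ≤ p < q`, all monotone sequences
of times `n_0 ≤ ⋯ ≤ n_{q-1}`, and every bounded separately `η`-Hölder `G : M^q → ℝ`
(with bound `Ginf` on `|G|` and separate Hölder constants `Gh i`), the correlation between
`G(T^{n_0}x, …, T^{n_{q-1}}x)` and the decoupled version (where the first `p` coordinates use
`x₀` and the remaining ones `x₁`) is at most
`C₀ (n_p - n_{p-1})^{-γ} (Ginf + ∑ i, Gh i)`. -/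
def FunctionalCorrelationBound {M : Type*} [MetricSpace M] [MeasurableSpace M]
    (μ : Measure M) (T : M → M) (η γ : ℝ) : Prop :=
  ∃ C₀ : ℝ, 0 < C₀ ∧
    ∀ (q p : ℕ), p < q →
    ∀ n : ℕ → ℕ, Monotone n → n (p - 1) < n p →
    ∀ G : (Fin q → M) → ℝ, Measurable G →
    ∀ Ginf : ℝ, 0 ≤ Ginf → (∀ x, |G x| ≤ Ginf) →
    ∀ Gh : Fin q → ℝ, (∀ i, 0 ≤ Gh i) →
    (∀ (i : Fin q) (x : Fin q → M) (y : M),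
        |G x - G (Function.update x i y)| ≤ Gh i * dist (x i) y ^ η) →
    |(∫ x, G (fun i => T^[n i] x) ∂μ) -
        ∫ x₀, ∫ x₁, G (fun i => if (i : ℕ) < p then T^[n i] x₀ else T^[n i] x₁) ∂μ ∂μ|
      ≤ C₀ * ((n p : ℝ) - (n (p - 1) : ℝ)) ^ (-γ) * (Ginf + ∑ i, Gh i)

theorem rpow_sub_rpow_le_mul {p x y : ℝ} (hp : 1 ≤ p) (hy : 0 ≤ y) (hyx : y ≤ x) :
    x ^ p - y ^ p ≤ p * x ^ (p - 1) * (x - y) := by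
  rcases (hy.trans hyx).eq_or_lt with hx | hx
  · have : y = 0 := by linarith
    subst this; subst hx; simp
  · have h := one_add_mul_self_le_rpow_one_add (s := y / x - 1)
      (by linarith [div_nonneg hy hx.le]) hp
    have e : 1 + (y / x - 1) = y / x := by ring
    rw [e, Real.div_rpow hy hx.le, le_div_iff₀ (Real.rpow_pos_of_pos hx p)] at h
    have hx1 : x ^ p = x ^ (p - 1) * x := by
      rw [Real.rpow_sub_one hx.ne']; field_simp
    have : (1 + p * (y / x - 1)) * x ^ p = x ^ p - p * x ^ (p - 1) * (x - y) := by
      rw [hx1]; field_simp; ring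
    linarith

theorem abs_rpow_sub_abs_rpow_le {p R a b : ℝ} (hp : 1 ≤ p) (ha : |a| ≤ R) (hb : |b| ≤ R) :
    |(|a| ^ p - |b| ^ p)| ≤ p * R ^ (p - 1) * |a - b| := by
  wlog hab : |b| ≤ |a| generalizing a b
  · rw [abs_sub_comm, abs_sub_comm a b]
    exact this hb ha (le_of_not_ge hab)
  rw [abs_of_nonneg (sub_nonneg.2 (Real.rpow_le_rpow (abs_nonneg _) hab (by linarith)))]
  refine (rpow_sub_rpow_le_mul hp (abs_nonneg b) hab).trans ?_
  have h1 : |a| ^ (p - 1) ≤ R ^ (p - 1) :=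
    Real.rpow_le_rpow (abs_nonneg _) ha (by linarith)
  have h2 : |a| - |b| ≤ |a - b| := abs_sub_abs_le_abs_sub a b
  have h3 : (0 : ℝ) ≤ R ^ (p - 1) := Real.rpow_nonneg ((abs_nonneg a).trans ha) _
  gcongr

theorem one_add_rpow_le_of_small {p t : ℝ} (hp : 1 ≤ p) (ht : |t| ≤ 1 / (4 * p)) :
    |1 + t| ^ p ≤ 1 + p * t + 4 * p ^ 2 * t ^ 2 := by
  have hp0 : 0 < p := by linarith
  have htp : p * |t| ≤ 1 / 4 := by
    calc p * |t| ≤ p * (1 / (4 * p)) := by gcongr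
      _ = 1 / 4 := by field_simp
  have ht4 : |t| ≤ 1 / 4 := by nlinarith [abs_nonneg t]
  obtain ⟨h1, h2⟩ := abs_le.1 ht4
  have hpos : 0 < 1 + t := by linarith
  rw [abs_of_pos hpos]
  set s := p * t / (1 + t) with hs
  have hsabs : |s| ≤ 1 / 3 := by
    rw [hs, abs_div, abs_mul, abs_of_pos hp0, abs_of_pos hpos, div_le_iff₀ hpos]
    linarith
  obtain ⟨hs1, hs2⟩ := abs_le.1 hsabs
  have hb := one_add_mul_self_le_rpow_one_add (s := -t / (1 + t))
    (by rw [le_div_iff₀ hpos]; linarith) hp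
  have e1 : 1 + -t / (1 + t) = (1 + t)⁻¹ := by field_simp; ring
  have e2 : 1 + p * (-t / (1 + t)) = 1 - s := by rw [hs]; ring
  rw [e1, e2, Real.inv_rpow hpos.le] at hb
  have hP : 0 < (1 + t) ^ p := Real.rpow_pos_of_pos hpos p
  have h3 : (1 + t) ^ p ≤ 1 + s + 2 * s ^ 2 := by
    have h4 : (1 - s) * (1 + t) ^ p ≤ 1 := by
      calc (1 - s) * (1 + t) ^ p ≤ ((1 + t) ^ p)⁻¹ * (1 + t) ^ p := by gcongr
        _ = 1 := inv_mul_cancel₀ hP.ne'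
    have h5 : 1 ≤ (1 - s) * (1 + s + 2 * s ^ 2) := by nlinarith [sq_nonneg s]
    exact le_of_mul_le_mul_left (h4.trans h5) (by linarith)
  have h6 : s * (1 + t) = p * t := by rw [hs]; field_simp
  have h7 : s ≤ p * t := by
    have : s = p * t - p * t ^ 2 / (1 + t) := by rw [hs]; field_simp; ring
    rw [this]
    have : 0 ≤ p * t ^ 2 / (1 + t) := by positivity
    linarith
  have h8 : s ^ 2 ≤ 2 * (p ^ 2 * t ^ 2) := by
    have : s ^ 2 * (1 + t) ^ 2 = p ^ 2 * t ^ 2 := by rw [← mul_pow, h6]; ring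
    rw [← this]
    nlinarith [sq_nonneg s, mul_nonneg (sq_nonneg s) (by nlinarith : 0 ≤ 2 * (1 + t) ^ 2 - 1)]
  nlinarith

theorem exists_abs_one_add_rpow_le {p : ℝ} (hp : 1 ≤ p) :
    ∃ K : ℝ, 1 ≤ K ∧ ∀ t : ℝ, |1 + t| ^ p ≤ 1 + p * t + K * |t| ^ p ∨
      (|t| ≤ 1 ∧ |1 + t| ^ p ≤ 1 + p * t + K * t ^ 2) := by
  have hp0 : 0 < p := by linarith
  have hA : (1 : ℝ) ≤ (1 + 4 * p) ^ p := Real.one_le_rpow (by linarith) hp0.le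
  have hB : (0 : ℝ) ≤ p * (4 * p) ^ (p - 1) := by positivity
  refine ⟨(1 + 4 * p) ^ p + p * (4 * p) ^ (p - 1) + 4 * p ^ 2, by nlinarith [sq_nonneg p], ?_⟩
  intro t
  rcases le_total |t| (1 / (4 * p)) with ht | ht
  · right
    refine ⟨ht.trans ?_, (one_add_rpow_le_of_small hp ht).trans ?_⟩
    · rw [div_le_one (by linarith)]; linarith
    · nlinarith [sq_nonneg t]
  · left
    have h1 : 1 ≤ 4 * p * |t| := by
      rw [div_le_iff₀ (by linarith)] at ht; linarith
    have ht0 : 0 < |t| := by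
      by_contra h
      nlinarith [abs_nonneg t]
    have h2 : |1 + t| ^ p ≤ (1 + 4 * p) ^ p * |t| ^ p := by
      rw [← Real.mul_rpow (by linarith) ht0.le]
      refine Real.rpow_le_rpow (abs_nonneg _) ?_ hp0.le
      calc |1 + t| ≤ |1| + |t| := abs_add_le _ _
        _ ≤ (1 + 4 * p) * |t| := by rw [abs_one]; linarith
    have h3 : |t| ≤ (4 * p) ^ (p - 1) * |t| ^ p := by
      have : |t| ^ p = |t| ^ (p - 1) * |t| := by
        rw [Real.rpow_sub_one ht0.ne']; field_simp
      rw [this, ← mul_assoc, ← Real.mul_rpow (by linarith) ht0.le]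
      exact le_mul_of_one_le_left ht0.le (Real.one_le_rpow h1 (by linarith))
    have h4 : -|t| ≤ t := neg_abs_le t
    have h5 : 0 ≤ |t| ^ p := by positivity
    have h6 : p * |t| ≤ p * ((4 * p) ^ (p - 1) * |t| ^ p) := by gcongr
    nlinarith [mul_nonneg (sq_nonneg p) h5]

theorem abs_add_rpow_eq {p a b : ℝ} (ha : a ≠ 0) :
    |a + b| ^ p = |a| ^ p * |1 + b / a| ^ p := by
  rw [← Real.mul_rpow (abs_nonneg _) (abs_nonneg _), ← abs_mul]
  congr 2
  field_simp

theorem exists_abs_add_rpow_le_of_le_two {p : ℝ} (hp : 1 < p) (hp2 : p ≤ 2) :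
    ∃ K : ℝ, 1 ≤ K ∧ ∀ a b : ℝ,
      |a + b| ^ p ≤ |a| ^ p + p * (|a| ^ p / a) * b + K * |b| ^ p := by
  obtain ⟨K, hK, h⟩ := exists_abs_one_add_rpow_le hp.le
  refine ⟨K, hK, fun a b => ?_⟩
  rcases eq_or_ne a 0 with rfl | ha
  · have : 0 ≤ |b| ^ p := by positivity
    simp [Real.zero_rpow (by linarith : p ≠ 0)]
    nlinarith
  have key : |1 + b / a| ^ p ≤ 1 + p * (b / a) + K * |b / a| ^ p := by
    rcases h (b / a) with h | ⟨h1, h⟩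
    · exact h
    · refine h.trans ?_
      have : (b / a) ^ 2 ≤ |b / a| ^ p := by
        rcases (abs_nonneg (b / a)).eq_or_lt with h0 | h0
        · rw [← sq_abs, ← h0]; simp [Real.zero_rpow (by linarith : p ≠ 0)]
        · rw [← sq_abs, ← Real.rpow_two]
          exact Real.rpow_le_rpow_of_exponent_ge h0 h1 hp2
      nlinarith
  rw [abs_add_rpow_eq ha]
  have hap : 0 < |a| ^ p := Real.rpow_pos_of_pos (abs_pos.2 ha) p
  calc |a| ^ p * |1 + b / a| ^ p ≤ |a| ^ p * (1 + p * (b / a) + K * |b / a| ^ p) := by gcongr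
    _ = _ := by
      rw [abs_div, Real.div_rpow (abs_nonneg _) (abs_nonneg _)]
      field_simp

theorem exists_abs_add_rpow_le_of_two_le {p : ℝ} (hp2 : 2 ≤ p) :
    ∃ K : ℝ, 1 ≤ K ∧ ∀ a b : ℝ,
      |a + b| ^ p ≤ |a| ^ p + p * (|a| ^ p / a) * b + K * (|b| ^ p + |a| ^ (p - 2) * b ^ 2) := by
  obtain ⟨K, hK, h⟩ := exists_abs_one_add_rpow_le (by linarith : 1 ≤ p)
  refine ⟨K, hK, fun a b => ?_⟩
  rcases eq_or_ne a 0 with rfl | ha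
  · have h1 : 0 ≤ |b| ^ p := by positivity
    have h2 : 0 ≤ |(0 : ℝ)| ^ (p - 2) * b ^ 2 := by positivity
    have h3 : |(0 : ℝ)| ^ p = 0 := by simp [Real.zero_rpow (by linarith : p ≠ 0)]
    simp only [h3, zero_add, zero_div, mul_zero, zero_mul]
    nlinarith
  have key : |1 + b / a| ^ p ≤ 1 + p * (b / a) + K * (|b / a| ^ p + (b / a) ^ 2) := by
    have h1 : 0 ≤ |b / a| ^ p := by positivity
    have h2 := sq_nonneg (b / a)
    rcases h (b / a) with h | ⟨-, h⟩ <;> nlinarith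
  rw [abs_add_rpow_eq ha]
  have hap : 0 < |a| ^ p := Real.rpow_pos_of_pos (abs_pos.2 ha) p
  have e : |a| ^ p = |a| ^ (p - 2) * a ^ 2 := by
    rw [← sq_abs a, ← Real.rpow_two, ← Real.rpow_add (abs_pos.2 ha)]; ring_nf
  have e2 : |a| ^ (p - 2) * b ^ 2 = |a| ^ p * (b / a) ^ 2 := by
    rw [e]; field_simp
  calc |a| ^ p * |1 + b / a| ^ p
      ≤ |a| ^ p * (1 + p * (b / a) + K * (|b / a| ^ p + (b / a) ^ 2)) := by gcongr
    _ = _ := by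
      rw [e2, abs_div, Real.div_rpow (abs_nonneg _) (abs_nonneg _)]
      field_simp

theorem abs_rpow_sub_two_le {p a l : ℝ} (hp : 2 ≤ p) (hl : 0 < l) :
    |a| ^ (p - 2) ≤ l ^ (p - 2) + |a| ^ p / l ^ 2 := by
  rcases le_total |a| l with h | h
  · have : |a| ^ (p - 2) ≤ l ^ (p - 2) := Real.rpow_le_rpow (abs_nonneg _) h (by linarith)
    have : 0 ≤ |a| ^ p / l ^ 2 := by positivity
    linarith
  · have ha : 0 < |a| := hl.trans_le h
    have e : |a| ^ p = |a| ^ (p - 2) * |a| ^ 2 := by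
      rw [← Real.rpow_two, ← Real.rpow_add ha]; ring_nf
    have h1 : |a| ^ (p - 2) ≤ |a| ^ p / l ^ 2 := by
      rw [le_div_iff₀ (by positivity), e]
      gcongr
    have : 0 ≤ l ^ (p - 2) := by positivity
    linarith

theorem sq_le_add_rpow {p b l : ℝ} (hp : 2 ≤ p) (hl : 0 < l) :
    b ^ 2 ≤ l ^ 2 + |b| ^ p * l ^ (2 - p) := by
  rw [← sq_abs]
  rcases le_total |b| l with h | h
  · have : 0 ≤ |b| ^ p * l ^ (2 - p) := by positivity
    have : |b| ^ 2 ≤ l ^ 2 := by gcongr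
    linarith
  · have hb : 0 < |b| := hl.trans_le h
    have h1 : |b| ^ (2 - p) ≤ l ^ (2 - p) := Real.rpow_le_rpow_of_nonpos hl h (by linarith)
    have : |b| ^ 2 = |b| ^ p * |b| ^ (2 - p) := by
      rw [← Real.rpow_two, ← Real.rpow_add hb]; ring_nf
    rw [this]
    have : |b| ^ p * |b| ^ (2 - p) ≤ |b| ^ p * l ^ (2 - p) := by gcongr
    nlinarith [sq_nonneg l]

/-- `FunctionalCorrelationBound` with an explicit constant. -/
def FunctionalCorrelationBoundWith {M : Type*} [MetricSpace M] [MeasurableSpace M]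
    (μ : Measure M) (T : M → M) (η γ C₀ : ℝ) : Prop :=
  ∀ (q p : ℕ), p < q →
    ∀ n : ℕ → ℕ, Monotone n → n (p - 1) < n p →
    ∀ G : (Fin q → M) → ℝ, Measurable G →
    ∀ Ginf : ℝ, 0 ≤ Ginf → (∀ x, |G x| ≤ Ginf) →
    ∀ Gh : Fin q → ℝ, (∀ i, 0 ≤ Gh i) →
    (∀ (i : Fin q) (x : Fin q → M) (y : M),
        |G x - G (Function.update x i y)| ≤ Gh i * dist (x i) y ^ η) →
    |(∫ x, G (fun i => T^[n i] x) ∂μ) -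
        ∫ x₀, ∫ x₁, G (fun i => if (i : ℕ) < p then T^[n i] x₀ else T^[n i] x₁) ∂μ ∂μ|
      ≤ C₀ * ((n p : ℝ) - (n (p - 1) : ℝ)) ^ (-γ) * (Ginf + ∑ i, Gh i)

/-- The forward orbit of a point, as a sequence. -/
def orbitSeq {M : Type*} (T : M → M) (x : M) : ℕ → M := fun i => T^[i] x

theorem orbitSeq_add {M : Type*} (T : M → M) (x : M) (s : ℕ) :
    (fun i => orbitSeq T x (s + i)) = orbitSeq T (T^[s] x) := by
  funext i
  simp only [orbitSeq]
  rw [add_comm, iterate_add_apply]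

/-- A measurable function of a sequence that depends only on the coordinates below `t`, is
bounded by `Q`, and is `η`-Hölder with constant `H` in each coordinate separately. -/
structure IsHolderFunctional {M : Type*} [MetricSpace M] [MeasurableSpace M]
    (η : ℝ) (t : ℕ) (Q H : ℝ) (A : (ℕ → M) → ℝ) : Prop where
  measurable : Measurable A
  congr : ∀ x y : ℕ → M, (∀ i < t, x i = y i) → A x = A y
  bound : ∀ x, |A x| ≤ Q
  holder : ∀ x l y, |A x - A (update x l y)| ≤ H * dist (x l) y ^ η

section Functionals

variable {M : Type*} [MetricSpace M] [MeasurableSpace M] {η : ℝ}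

theorem IsHolderFunctional.mono {t t' : ℕ} {Q H Q' : ℝ} {A : (ℕ → M) → ℝ}
    (hA : IsHolderFunctional η t Q H A) (ht : t ≤ t') (hQ : Q ≤ Q') :
    IsHolderFunctional η t' Q' H A where
  measurable := hA.measurable
  congr x y h := hA.congr x y fun i hi => h i (hi.trans_le ht)
  bound x := (hA.bound x).trans hQ
  holder := hA.holder

theorem measurable_shift {M : Type*} [MeasurableSpace M] (s : ℕ) :
    Measurable (fun (x : ℕ → M) (i : ℕ) => x (s + i)) :=
  measurable_pi_lambda _ fun i => measurable_pi_apply (s + i)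

theorem IsHolderFunctional.add_shift {t m s : ℕ} {Q Q' H : ℝ} {A B : (ℕ → M) → ℝ}
    (hA : IsHolderFunctional η t Q H A) (hB : IsHolderFunctional η m Q' H B) (hs : t ≤ s) :
    IsHolderFunctional η (s + m) (Q + Q') H (fun x => A x + B (fun i => x (s + i))) where
  measurable := hA.measurable.add (hB.measurable.comp (measurable_shift s))
  congr x y h := by
    rw [hA.congr x y fun i hi => h i (by omega),
      hB.congr (fun i => x (s + i)) (fun i => y (s + i)) fun i hi => h (s + i) (by omega)]
  bound x := (abs_add_le _ _).trans (add_le_add (hA.bound _) (hB.bound _))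
  holder x l y := by
    rcases lt_or_ge l s with hl | hl
    · have e : (fun i => update x l y (s + i)) = fun i => x (s + i) := by
        funext i
        exact update_of_ne (by omega) _ _
      rw [e, add_sub_add_right_eq_sub]
      exact hA.holder x l y
    · have e : (fun i => update x l y (s + i)) = update (fun i => x (s + i)) (l - s) y := by
        funext i
        by_cases hi : i = l - s
        · subst hi
          rw [update_self, show s + (l - s) = l by omega, update_self]
        · rw [update_of_ne hi, update_of_ne (by omega)]
      have e2 : A (update x l y) = A x :=
        hA.congr _ _ fun i hi => update_of_ne (by omega) _ _
      have h := hB.holder (fun i => x (s + i)) (l - s) y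
      rw [e, e2, add_sub_add_left_eq_sub]
      simpa only [show s + (l - s) = l by omega] using h

variable {μ : Measure M} [IsProbabilityMeasure μ] {T : M → M}

theorem measurable_orbitSeq {M : Type*} [MeasurableSpace M] {T : M → M} (hT : Measurable T) :
    Measurable (orbitSeq T) :=
  measurable_pi_lambda _ fun i => hT.iterate i

theorem integrable_abs_rpow {M : Type*} [MeasurableSpace M] {μ : Measure M}
    [IsProbabilityMeasure μ] {f : M → ℝ} {Q p : ℝ} (hf : Measurable f)
    (hQ : ∀ x, |f x| ≤ Q) (hp : 0 ≤ p) : Integrable (fun x => |f x| ^ p) μ := by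
  refine Integrable.of_bound (C := Q ^ p) (by fun_prop) (ae_of_all _ fun x => ?_)
  rw [Real.norm_of_nonneg (by positivity)]
  exact Real.rpow_le_rpow (abs_nonneg _) (hQ x) hp

theorem integral_comp_iterate {M : Type*} [MeasurableSpace M] {μ : Measure M} {T : M → M}
    (hT : MeasurePreserving T μ μ) {f : M → ℝ} (hf : Measurable f)
    (s : ℕ) : ∫ x, f (T^[s] x) ∂μ = ∫ x, f x ∂μ := by
  have h := (hT.iterate s).map_eq
  conv_rhs => rw [← h]
  rw [integral_map (hT.iterate s).measurable.aemeasurable hf.aestronglyMeasurable]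

theorem integral_abs_add_rpow_le_decoupled {γ C₀ : ℝ} (hT : MeasurePreserving T μ μ)
    (hF : FunctionalCorrelationBoundWith μ T η γ C₀)
    {t m s : ℕ} {Q Q' H p : ℝ} {A B : (ℕ → M) → ℝ} (hH : 0 ≤ H)
    (hA : IsHolderFunctional η t Q H A) (hB : IsHolderFunctional η m Q' H B)
    (ht : 1 ≤ t) (hm : 1 ≤ m) (hs : t ≤ s) (hp : 1 ≤ p) :
    ∫ x, |A (orbitSeq T x) + B (orbitSeq T (T^[s] x))| ^ p ∂μ ≤
      (∫ x, ∫ y, |A (orbitSeq T x) + B (orbitSeq T y)| ^ p ∂μ ∂μ) +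
      C₀ * ((s : ℝ) - t + 1) ^ (-γ) *
        ((Q + Q') ^ p + (t + m : ℝ) * (p * (Q + Q') ^ (p - 1) * H)) := by
  obtain ⟨x₀⟩ : Nonempty M := nonempty_of_isProbabilityMeasure μ
  have hC := hA.add_shift hB le_rfl
  set E : (Fin (t + m) → M) → ℕ → M := fun x i => if h : i < t + m then x ⟨i, h⟩ else x₀ with hE
  have hEm : Measurable E := by
    refine measurable_pi_lambda _ fun i => ?_
    by_cases h : i < t + m
    · simp only [hE, h, dite_true]; exact measurable_pi_apply _
    · simp only [hE, h, dite_false]; exact measurable_const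
  have hEu : ∀ x (i : Fin (t + m)) y, E (update x i y) = update (E x) i y := by
    intro x i y
    funext j
    by_cases hj : j = (i : ℕ)
    · subst hj
      simp [hE]
    · rw [update_of_ne hj]
      simp only [hE]
      split_ifs with h
      · rw [update_of_ne]
        intro h'
        exact hj (by rw [← h'])
      · rfl
  have hR : 0 ≤ Q + Q' := (abs_nonneg _).trans (hC.bound fun _ => x₀)
  set R := Q + Q'
  set n : ℕ → ℕ := fun i => if i < t then i else i - t + s with hn
  have hnm : Monotone n := by
    intro i j hij
    simp only [hn]
    split_ifs <;> omega
  have hnt : n t = s := by simp [hn]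
  have hnt1 : n (t - 1) = t - 1 := by simp only [hn]; rw [if_pos (by omega)]
  set G : (Fin (t + m) → M) → ℝ := fun x => |A (E x) + B (fun i => E x (t + i))| ^ p with hG
  have hL : 0 ≤ p * R ^ (p - 1) := by positivity
  have main := hF (t + m) t (by omega) n hnm (by omega) G
    (((hC.measurable.comp hEm).abs).pow_const p) (R ^ p) (by positivity)
    (fun x => by
      simp only [hG]
      rw [abs_of_nonneg (by positivity)]
      exact Real.rpow_le_rpow (abs_nonneg _) (hC.bound _) (by linarith))
    (fun _ => p * R ^ (p - 1) * H) (fun _ => by positivity)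
    (fun i x y => by
      simp only [hG]
      rw [hEu]
      refine (abs_rpow_sub_abs_rpow_le hp (hC.bound _) (hC.bound _)).trans ?_
      have h := hC.holder (E x) i y
      have e : E x i = x i := by simp [hE]
      rw [e] at h
      calc _ ≤ p * R ^ (p - 1) * (H * dist (x i) y ^ η) := by gcongr
        _ = _ := by ring)
  have hAe : ∀ x y z : M, A (E fun i => if (i : ℕ) < t then T^[n i] x else T^[n i] y) =
      A (orbitSeq T x) := by
    intro x y _
    refine hA.congr _ _ fun i hi => ?_
    simp only [hE, hn, orbitSeq]
    rw [dif_pos (by omega), if_pos hi, if_pos hi]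
  have hBe : ∀ x y : M, B (fun j => E (fun i => if (i : ℕ) < t then T^[n i] x else T^[n i] y)
      (t + j)) = B (orbitSeq T (T^[s] y)) := by
    intro x y
    refine hB.congr _ _ fun i hi => ?_
    simp only [hE, hn, orbitSeq]
    rw [dif_pos (by omega), if_neg (by omega), if_neg (by omega), Nat.add_sub_cancel_left,
      iterate_add_apply]
  have e1 : ∀ x : M, G (fun i => T^[n i] x) =
      |A (orbitSeq T x) + B (orbitSeq T (T^[s] x))| ^ p := by
    intro x
    have h1 := hAe x x x
    have h2 := hBe x x
    simp only [ite_self] at h1 h2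
    simp only [hG]
    rw [h1, h2]
  have e2 : ∀ x : M, ∫ y, G (fun i => if (i : ℕ) < t then T^[n i] x else T^[n i] y) ∂μ =
      ∫ y, |A (orbitSeq T x) + B (orbitSeq T y)| ^ p ∂μ := by
    intro x
    simp only [hG, hAe x _ x, hBe]
    have hb : Measurable fun y => |A (orbitSeq T x) + B (orbitSeq T y)| ^ p :=
      ((measurable_const.add
        (hB.measurable.comp (measurable_orbitSeq hT.measurable))).abs).pow_const p
    exact integral_comp_iterate hT hb s
  simp only [e1, e2, hnt, hnt1] at main
  have e3 : ((s : ℝ) - ((t - 1 : ℕ) : ℝ)) = (s : ℝ) - t + 1 := by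
    rw [Nat.cast_sub ht]; push_cast; ring
  rw [e3, Finset.sum_const, Finset.card_univ, Fintype.card_fin, nsmul_eq_mul] at main
  have := (abs_le.1 main).2
  push_cast at this
  linarith

end Functionals

section Moments

variable {M : Type*} [MetricSpace M] [MeasurableSpace M] {η : ℝ}

/-- The sum of `B` over `r` windows of a sequence, the `i`-th window starting at `(2 i + 1) m`. -/
def spacedSum {M : Type*} (m : ℕ) (B : (ℕ → M) → ℝ) (r : ℕ) (x : ℕ → M) : ℝ :=
  ∑ i ∈ Finset.range r, B (fun l => x ((2 * i + 1) * m + l))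

theorem IsHolderFunctional.spacedSum {m : ℕ} {Q H : ℝ} {B : (ℕ → M) → ℝ} (hm : 1 ≤ m)
    (hH : 0 ≤ H) (hB : IsHolderFunctional η m Q H B) (r : ℕ) :
    IsHolderFunctional η (2 * r * m + 1) (r * Q) H (spacedSum m B r) := by
  induction r with
  | zero =>
    refine ⟨?_, fun _ _ _ => rfl, fun _ => ?_, fun x l y => ?_⟩
    · have e : _root_.spacedSum m B 0 = fun _ => 0 := by
        funext x
        simp [_root_.spacedSum]
      rw [e]
      exact measurable_const
    · simp [_root_.spacedSum]
    · simp only [_root_.spacedSum, Finset.range_zero, Finset.sum_empty, sub_self, abs_zero]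
      positivity
  | succ r ih =>
    have h := (ih.add_shift hB (s := (2 * r + 1) * m) (by nlinarith)).mono
      (t' := 2 * (r + 1) * m + 1) (Q' := ((r + 1 : ℕ) : ℝ) * Q) (by nlinarith)
      (by push_cast; linarith)
    have e : _root_.spacedSum m B (r + 1) = fun x => _root_.spacedSum m B r x +
        B (fun i => x ((2 * r + 1) * m + i)) := by
      funext x
      simp only [_root_.spacedSum, Finset.sum_range_succ]
    rw [e]
    exact h

variable {μ : Measure M} [IsProbabilityMeasure μ] {T : M → M}

theorem integral_abs_spacedSum_succ_le {γ C₀ : ℝ} (hT : MeasurePreserving T μ μ)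
    (hF : FunctionalCorrelationBoundWith μ T η γ C₀) (hC₀ : 0 ≤ C₀)
    {m : ℕ} {Q H p : ℝ} {B : (ℕ → M) → ℝ} (hm : 1 ≤ m)
    (hB : IsHolderFunctional η m Q H B) (hH : 0 ≤ H) (hHQ : H * m ≤ Q) (hp : 1 ≤ p)
    {r k : ℕ} (hr : r < k) :
    ∫ x, |spacedSum m B (r + 1) (orbitSeq T x)| ^ p ∂μ ≤
      (∫ x, ∫ y, |spacedSum m B r (orbitSeq T x) + B (orbitSeq T y)| ^ p ∂μ ∂μ) +
      C₀ * (m : ℝ) ^ (-γ) * ((1 + 2 * p) * (k * Q) ^ p) := by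
  have hQ : 0 ≤ Q := le_trans (by positivity) hHQ
  have h := integral_abs_add_rpow_le_decoupled hT hF hH (hB.spacedSum hm hH r) hB
    (s := (2 * r + 1) * m) (by omega) hm (by nlinarith) hp
  have e : ∀ x, spacedSum m B (r + 1) (orbitSeq T x) = spacedSum m B r (orbitSeq T x) +
      B (orbitSeq T (T^[(2 * r + 1) * m] x)) := by
    intro x
    rw [← orbitSeq_add]
    simp only [spacedSum, Finset.sum_range_succ]
  simp only [e]
  refine h.trans (add_le_add_right ?_ _)
  have e1 : (((2 * r + 1) * m : ℕ) : ℝ) - ((2 * r * m + 1 : ℕ) : ℝ) + 1 = m := by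
    push_cast; ring
  rw [e1]
  refine mul_le_mul_of_nonneg_left ?_ (by positivity)
  have hrk : (r : ℝ) + 1 ≤ k := by exact_mod_cast hr
  have hm' : (1 : ℝ) ≤ m := by exact_mod_cast hm
  have hR : (r : ℝ) * Q + Q ≤ k * Q := by nlinarith
  have hR0 : 0 ≤ (r : ℝ) * Q + Q := by positivity
  have h1 : ((r : ℝ) * Q + Q) ^ p ≤ (k * Q) ^ p := Real.rpow_le_rpow hR0 hR (by linarith)
  have h2 : ((r : ℝ) * Q + Q) ^ (p - 1) ≤ (k * Q) ^ (p - 1) :=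
    Real.rpow_le_rpow hR0 hR (by linarith)
  have h3 : ((2 * r * m + 1 : ℕ) : ℝ) + m ≤ 2 * k * m := by
    push_cast
    nlinarith
  have h4 : (k * Q) ^ (p - 1) * (k * Q) = (k * Q) ^ p := by
    rcases (show 0 ≤ k * Q by positivity).eq_or_lt with h0 | h0
    · rw [← h0, Real.zero_rpow (by linarith : p ≠ 0), mul_zero]
    · rw [Real.rpow_sub_one h0.ne', div_mul_cancel₀ _ h0.ne']
  have h5 : 0 ≤ (k * Q) ^ (p - 1) := by positivity
  calc ((r : ℝ) * Q + Q) ^ p +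
        (((2 * r * m + 1 : ℕ) : ℝ) + m) * (p * ((r : ℝ) * Q + Q) ^ (p - 1) * H)
      ≤ (k * Q) ^ p + (2 * k * m) * (p * (k * Q) ^ (p - 1) * H) := by gcongr
    _ = (k * Q) ^ p + 2 * p * ((k * Q) ^ (p - 1) * (k * (H * m))) := by ring
    _ ≤ (k * Q) ^ p + 2 * p * ((k * Q) ^ (p - 1) * (k * Q)) := by gcongr
    _ = _ := by rw [h4]; ring

theorem integral_abs_add_rpow_le_of_integral_eq_zero {M : Type*} [MeasurableSpace M]
    {μ : Measure M} [IsProbabilityMeasure μ] {f : M → ℝ} {Q p a c K θ : ℝ}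
    (hf : Measurable f) (hQ : ∀ x, |f x| ≤ Q) (hf0 : ∫ x, f x ∂μ = 0) (hp : 0 ≤ p)
    (h : ∀ b : ℝ, |a + b| ^ p ≤ |a| ^ p + c * b + K * (|b| ^ p + θ * b ^ 2)) :
    ∫ x, |a + f x| ^ p ∂μ ≤ |a| ^ p + K * ((∫ x, |f x| ^ p ∂μ) + θ * ∫ x, f x ^ 2 ∂μ) := by
  have i1 : Integrable f μ := Integrable.of_bound hf.aestronglyMeasurable Q (ae_of_all _ hQ)
  have i2 : Integrable (fun x => |f x| ^ p) μ := integrable_abs_rpow hf hQ hp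
  have i3 : Integrable (fun x => f x ^ 2) μ := by
    have := integrable_abs_rpow (μ := μ) hf hQ (p := 2) (by norm_num)
    simpa using this
  have i4 : Integrable (fun x => |a| ^ p + c * f x) μ := (integrable_const _).add (i1.const_mul c)
  have i5 : Integrable (fun x => |f x| ^ p + θ * f x ^ 2) μ := i2.add (i3.const_mul θ)
  calc ∫ x, |a + f x| ^ p ∂μ
      ≤ ∫ x, (|a| ^ p + c * f x + K * (|f x| ^ p + θ * f x ^ 2)) ∂μ :=
        integral_mono_of_nonneg (ae_of_all _ fun x => by positivity)
          (i4.add (i5.const_mul K)) (ae_of_all _ fun x => h (f x))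
    _ = _ := by
      rw [integral_add i4 (i5.const_mul K), integral_add (integrable_const _) (i1.const_mul c),
        integral_const_mul, integral_const_mul, integral_add i2 (i3.const_mul θ),
        integral_const_mul, hf0]
      simp

theorem exists_integral_abs_spacedSum_le_of_le_two {p : ℝ} (hp : 1 < p) (hp2 : p ≤ 2) :
    ∃ K : ℝ, 1 ≤ K ∧ ∀ {γ C₀ : ℝ}, MeasurePreserving T μ μ →
      FunctionalCorrelationBoundWith μ T η γ C₀ → 0 ≤ C₀ →
      ∀ {m : ℕ} {Q H β : ℝ} {B : (ℕ → M) → ℝ}, 1 ≤ m → IsHolderFunctional η m Q H B →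
      0 ≤ H → H * m ≤ Q → ∫ x, B (orbitSeq T x) ∂μ = 0 →
      ∫ x, |B (orbitSeq T x)| ^ p ∂μ ≤ β → ∀ k : ℕ,
      ∫ x, |spacedSum m B k (orbitSeq T x)| ^ p ∂μ ≤
        k * (C₀ * (m : ℝ) ^ (-γ) * ((1 + 2 * p) * (k * Q) ^ p) + K * β) := by
  obtain ⟨K, hK, h⟩ := exists_abs_add_rpow_le_of_le_two hp hp2
  refine ⟨K, hK, fun {γ C₀} hT hF hC₀ {m Q H β B} hm hB hH hHQ hB0 hβ k => ?_⟩
  set E := C₀ * (m : ℝ) ^ (-γ) * ((1 + 2 * p) * (k * Q) ^ p)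
  have key : ∀ r ≤ k, ∫ x, |spacedSum m B r (orbitSeq T x)| ^ p ∂μ ≤ r * (E + K * β) := by
    intro r
    induction r with
    | zero =>
      intro _
      simp [spacedSum, Real.zero_rpow (by linarith : p ≠ 0)]
    | succ r ih =>
      intro hr
      have hA := hB.spacedSum hm hH r
      have iA : Integrable (fun x => |spacedSum m B r (orbitSeq T x)| ^ p) μ :=
        integrable_abs_rpow (hA.measurable.comp (measurable_orbitSeq hT.measurable))
          (fun x => hA.bound _) (by linarith)
      have h2 : ∫ x, ∫ y, |spacedSum m B r (orbitSeq T x) + B (orbitSeq T y)| ^ p ∂μ ∂μ ≤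
          ∫ x, (|spacedSum m B r (orbitSeq T x)| ^ p + K * β) ∂μ := by
        refine integral_mono_of_nonneg (ae_of_all _ fun x => integral_nonneg fun y => by positivity)
          (iA.add (integrable_const _)) (ae_of_all _ fun x => ?_)
        refine (integral_abs_add_rpow_le_of_integral_eq_zero (θ := 0)
          (hB.measurable.comp (measurable_orbitSeq hT.measurable)) (fun y => hB.bound _) hB0
          (by linarith) (fun b => by simpa using h _ b)).trans ?_
        have : K * ∫ x, |B (orbitSeq T x)| ^ p ∂μ ≤ K * β := by gcongr
        simpa using this
      rw [integral_add iA (integrable_const _)] at h2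
      have h3 := integral_abs_spacedSum_succ_le hT hF hC₀ hm hB hH hHQ hp.le (r := r) hr
      have h4 := ih (by omega)
      simp only [integral_const, probReal_univ, smul_eq_mul, one_mul] at h2
      push_cast
      linarith
  exact key k le_rfl

theorem exists_integral_abs_spacedSum_le_of_two_le {p : ℝ} (hp2 : 2 ≤ p) :
    ∃ K : ℝ, 1 ≤ K ∧ ∀ {γ C₀ : ℝ}, MeasurePreserving T μ μ →
      FunctionalCorrelationBoundWith μ T η γ C₀ → 0 ≤ C₀ →
      ∀ {m : ℕ} {Q H β β₂ : ℝ} {B : (ℕ → M) → ℝ}, 1 ≤ m → IsHolderFunctional η m Q H B →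
      0 ≤ H → H * m ≤ Q → ∫ x, B (orbitSeq T x) ∂μ = 0 →
      ∫ x, |B (orbitSeq T x)| ^ p ∂μ ≤ β → 0 < β₂ → ∫ x, B (orbitSeq T x) ^ 2 ∂μ ≤ β₂ →
      ∀ k : ℕ, 1 ≤ k →
      ∫ x, |spacedSum m B k (orbitSeq T x)| ^ p ∂μ ≤
        3 * k * (C₀ * (m : ℝ) ^ (-γ) * ((1 + 2 * p) * (k * Q) ^ p) + K * β) +
          (6 * K * k * β₂) ^ (p / 2) := by
  obtain ⟨K, hK, h⟩ := exists_abs_add_rpow_le_of_two_le hp2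
  refine ⟨K, hK, fun {γ C₀} hT hF hC₀ {m Q H β β₂ B} hm hB hH hHQ hB0 hβ hβ₂0 hβ₂ k hk => ?_⟩
  have hQ : 0 ≤ Q := le_trans (by positivity) hHQ
  have hβ0 : 0 ≤ β := le_trans (integral_nonneg fun x => by positivity) hβ
  have hE0 : 0 ≤ C₀ * (m : ℝ) ^ (-γ) * ((1 + 2 * p) * (k * Q) ^ p) := by positivity
  set E := C₀ * (m : ℝ) ^ (-γ) * ((1 + 2 * p) * (k * Q) ^ p)
  have hk' : (1 : ℝ) ≤ k := by exact_mod_cast hk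
  have hk0 : (0 : ℝ) < k := by linarith
  have hV0 : 0 < (6 * K * k * β₂) ^ (p / 2) := by positivity
  set U := 3 * k * (E + K * β) + (6 * K * k * β₂) ^ (p / 2) with hU
  have hUV : (6 * K * k * β₂) ^ (p / 2) ≤ U := by
    rw [hU]
    have : 0 ≤ 3 * k * (E + K * β) := by positivity
    linarith
  have hU0 : 0 < U := hV0.trans_le hUV
  have hp0 : p ≠ 0 := by linarith
  set l := U ^ (1 / p) with hl
  have hl0 : 0 < l := by positivity
  have hlp : l ^ p = U := by
    rw [hl, ← Real.rpow_mul hU0.le, one_div_mul_cancel hp0, Real.rpow_one]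
  have hl2 : 6 * K * k * β₂ ≤ l ^ 2 := by
    have h1 := Real.rpow_le_rpow hV0.le hUV (z := 2 / p) (by positivity)
    rw [← Real.rpow_mul (by positivity), show p / 2 * (2 / p) = 1 by field_simp,
      Real.rpow_one] at h1
    have h2 : l ^ 2 = U ^ (2 / p) := by
      rw [hl, ← Real.rpow_two, ← Real.rpow_mul hU0.le]
      congr 1; ring
    rwa [h2]
  have hlU : U = l ^ (p - 2) * l ^ 2 := by
    rw [← hlp, ← Real.rpow_two, ← Real.rpow_add hl0]; ring_nf
  have hlq : 0 < l ^ (p - 2) := by positivity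
  have hkey : K * β₂ * (2 * l ^ (p - 2)) * k ≤ U / 3 := by
    have : l ^ (p - 2) * (6 * K * k * β₂) ≤ l ^ (p - 2) * l ^ 2 := by gcongr
    rw [← hlU] at this
    linarith
  have hEU : (E + K * β) * k ≤ U / 3 := by
    rw [hU]; linarith
  have hinc : E + K * β + K * β₂ * (2 * l ^ (p - 2)) ≤ U / k := by
    rw [le_div_iff₀ hk0]
    rw [hU] at hEU ⊢
    nlinarith
  have key : ∀ r ≤ k, ∫ x, |spacedSum m B r (orbitSeq T x)| ^ p ∂μ ≤ r * (U / k) := by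
    intro r
    induction r with
    | zero =>
      intro _
      simp [spacedSum, Real.zero_rpow hp0]
    | succ r ih =>
      intro hr
      have hA := hB.spacedSum hm hH r
      have mA : Measurable fun x => spacedSum m B r (orbitSeq T x) :=
        hA.measurable.comp (measurable_orbitSeq hT.measurable)
      have iA : Integrable (fun x => |spacedSum m B r (orbitSeq T x)| ^ p) μ :=
        integrable_abs_rpow mA (fun x => hA.bound _) (by linarith)
      have h4 := ih (by omega)
      set u := ∫ x, |spacedSum m B r (orbitSeq T x)| ^ p ∂μ with hu
      have huU : u ≤ U := by
        refine h4.trans ?_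
        have : (r : ℝ) ≤ k := by exact_mod_cast (by omega : r ≤ k)
        calc (r : ℝ) * (U / k) ≤ k * (U / k) := by gcongr
          _ = U := by field_simp
      have iq : Integrable (fun x => l ^ (p - 2) +
          |spacedSum m B r (orbitSeq T x)| ^ p / l ^ 2) μ :=
        (integrable_const _).add (iA.div_const _)
      have iq2 : Integrable (fun x => K * β + K * β₂ * (l ^ (p - 2) +
          |spacedSum m B r (orbitSeq T x)| ^ p / l ^ 2)) μ :=
        (integrable_const _).add (iq.const_mul _)
      have h2 : ∫ x, ∫ y, |spacedSum m B r (orbitSeq T x) + B (orbitSeq T y)| ^ p ∂μ ∂μ ≤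
          ∫ x, (|spacedSum m B r (orbitSeq T x)| ^ p + (K * β + K * β₂ *
            (l ^ (p - 2) + |spacedSum m B r (orbitSeq T x)| ^ p / l ^ 2))) ∂μ := by
        refine integral_mono_of_nonneg (ae_of_all _ fun x => integral_nonneg fun y => by positivity)
          (iA.add iq2) (ae_of_all _ fun x => ?_)
        refine (integral_abs_add_rpow_le_of_integral_eq_zero
          (hB.measurable.comp (measurable_orbitSeq hT.measurable)) (fun y => hB.bound _) hB0
          (by linarith) (h _)).trans ?_
        have h5 := abs_rpow_sub_two_le (a := spacedSum m B r (orbitSeq T x)) hp2 hl0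
        refine add_le_add_right ?_ _
        rw [mul_assoc, ← mul_add, mul_comm β₂]
        simp only [comp_apply]
        gcongr
      rw [integral_add iA iq2,
        integral_add (integrable_const _) (iq.const_mul _), integral_const_mul (K * β₂),
        integral_add (integrable_const _) (iA.div_const _), integral_div, ← hu] at h2
      have h3 := integral_abs_spacedSum_succ_le hT hF hC₀ hm hB hH hHQ
        (by linarith : 1 ≤ p) (r := r) hr
      simp only [integral_const, probReal_univ, smul_eq_mul, one_mul] at h2
      have h6 : u / l ^ 2 ≤ l ^ (p - 2) := by
        rw [div_le_iff₀ (by positivity), ← hlU]; exact huU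
      have h7 : K * β₂ * (l ^ (p - 2) + u / l ^ 2) ≤ K * β₂ * (2 * l ^ (p - 2)) := by
        gcongr; linarith
      push_cast
      linarith
  have := key k le_rfl
  rwa [mul_div_cancel₀ _ hk0.ne'] at this

end Moments

/-- A measurable function bounded by `1` and `η`-Hölder with constant `1`. -/
structure IsUnitHolder {M : Type*} [MetricSpace M] [MeasurableSpace M] (η : ℝ) (v : M → ℝ) :
    Prop where
  measurable : Measurable v
  bound : ∀ x, |v x| ≤ 1
  holder : ∀ x y, |v x - v y| ≤ dist x y ^ η

/-- The sum of `v` over the first `m` terms of a sequence. -/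
def seqSum {M : Type*} (v : M → ℝ) (m : ℕ) (x : ℕ → M) : ℝ :=
  ∑ i ∈ Finset.range m, v (x i)

/-- The iterated sum of `v` and `w` over the first `m` terms of a sequence. -/
def iteratedSum {M : Type*} (v w : M → ℝ) (m : ℕ) (x : ℕ → M) : ℝ :=
  ∑ j ∈ Finset.range m, ∑ i ∈ Finset.range j, v (x i) * w (x j)

theorem seqSum_add_orbitSeq {M : Type*} (v : M → ℝ) (T : M → M) (s m : ℕ) (x : M) :
    seqSum v (s + m) (orbitSeq T x) =
      seqSum v s (orbitSeq T x) + seqSum v m (orbitSeq T (T^[s] x)) := by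
  rw [← orbitSeq_add]
  simp only [seqSum, Finset.sum_range_add]

theorem iteratedSum_succ {M : Type*} (v w : M → ℝ) (m : ℕ) (x : ℕ → M) :
    iteratedSum v w (m + 1) x = iteratedSum v w m x + seqSum v m x * w (x m) := by
  simp only [iteratedSum, seqSum, Finset.sum_range_succ, Finset.sum_mul]

theorem iteratedSum_add_orbitSeq {M : Type*} (v w : M → ℝ) (T : M → M) (s m : ℕ) (x : M) :
    iteratedSum v w (s + m) (orbitSeq T x) =
      iteratedSum v w s (orbitSeq T x) + iteratedSum v w m (orbitSeq T (T^[s] x)) +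
        seqSum v s (orbitSeq T x) * seqSum w m (orbitSeq T (T^[s] x)) := by
  induction m with
  | zero => simp [iteratedSum, seqSum]
  | succ m ih =>
    have e : orbitSeq T x (s + m) = orbitSeq T (T^[s] x) m := by rw [← orbitSeq_add]
    have e2 : seqSum w (m + 1) (orbitSeq T (T^[s] x)) =
        seqSum w m (orbitSeq T (T^[s] x)) + w (orbitSeq T (T^[s] x) m) := by
      simp only [seqSum, Finset.sum_range_succ]
    rw [← add_assoc, iteratedSum_succ, ih, iteratedSum_succ, seqSum_add_orbitSeq, e, e2]
    ring

theorem seqSum_sq {M : Type*} (v : M → ℝ) (m : ℕ) (x : ℕ → M) :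
    seqSum v m x ^ 2 = ∑ j ∈ Finset.range m, v (x j) ^ 2 + 2 * iteratedSum v v m x := by
  induction m with
  | zero => simp [iteratedSum, seqSum]
  | succ m ih =>
    have e2 : seqSum v (m + 1) x = seqSum v m x + v (x m) := by
      simp only [seqSum, Finset.sum_range_succ]
    rw [iteratedSum_succ, Finset.sum_range_succ, e2, add_sq, ih]
    ring

theorem seqSum_mul_orbitSeq {M : Type*} (v : M → ℝ) (T : M → M) (m j : ℕ) (x : M) :
    seqSum v (j * m) (orbitSeq T x) =
      ∑ i ∈ Finset.range j, seqSum v m (orbitSeq T (T^[i * m] x)) := by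
  induction j with
  | zero => simp [seqSum]
  | succ j ih => rw [add_one_mul, seqSum_add_orbitSeq, ih, Finset.sum_range_succ]

theorem iteratedSum_mul_orbitSeq {M : Type*} (v w : M → ℝ) (T : M → M) (m j : ℕ) (x : M) :
    iteratedSum v w (j * m) (orbitSeq T x) =
      ∑ i ∈ Finset.range j, iteratedSum v w m (orbitSeq T (T^[i * m] x)) +
        ∑ i ∈ Finset.range j,
          seqSum v (i * m) (orbitSeq T x) * seqSum w m (orbitSeq T (T^[i * m] x)) := by
  induction j with
  | zero => simp [iteratedSum]
  | succ j ih =>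
    rw [add_one_mul, iteratedSum_add_orbitSeq, ih, Finset.sum_range_succ, Finset.sum_range_succ]
    ring

section Observables

variable {M : Type*} [MetricSpace M] [MeasurableSpace M] {η : ℝ} {v w : M → ℝ}

theorem IsUnitHolder.abs_seqSum_le (hv : IsUnitHolder η v) (m : ℕ) (x : ℕ → M) :
    |seqSum v m x| ≤ m := by
  refine (Finset.abs_sum_le_sum_abs _ _).trans ?_
  refine (Finset.sum_le_sum fun i _ => hv.bound (x i)).trans ?_
  simp

theorem abs_iteratedSum_le (hv : IsUnitHolder η v) (hw : IsUnitHolder η w) (m : ℕ)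
    (x : ℕ → M) : |iteratedSum v w m x| ≤ (m : ℝ) ^ 2 := by
  induction m with
  | zero => simp [iteratedSum]
  | succ m ih =>
    rw [iteratedSum_succ]
    refine (abs_add_le _ _).trans ?_
    rw [abs_mul]
    have h1 := hv.abs_seqSum_le m x
    have h2 := hw.bound (x m)
    have : |seqSum v m x| * |w (x m)| ≤ m * 1 := by gcongr
    push_cast
    nlinarith

theorem IsUnitHolder.abs_sub_update_le (hv : IsUnitHolder η v) (x : ℕ → M) (l : ℕ) (y : M)
    (i : ℕ) : |v (x i) - v (update x l y i)| ≤ if i = l then dist (x l) y ^ η else 0 := by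
  split_ifs with h
  · subst h
    rw [update_self]
    exact hv.holder _ _
  · rw [update_of_ne h]
    simp

theorem IsUnitHolder.abs_seqSum_sub_update_le (hv : IsUnitHolder η v) (m : ℕ) (x : ℕ → M)
    (l : ℕ) (y : M) : |seqSum v m x - seqSum v m (update x l y)| ≤ dist (x l) y ^ η := by
  simp only [seqSum]
  rw [← Finset.sum_sub_distrib]
  refine (Finset.abs_sum_le_sum_abs _ _).trans ?_
  refine (Finset.sum_le_sum fun i _ => hv.abs_sub_update_le x l y i).trans ?_
  rw [Finset.sum_ite_eq']
  split_ifs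
  · exact le_rfl
  · positivity

theorem IsUnitHolder.isHolderFunctional_seqSum (hv : IsUnitHolder η v) (m : ℕ) :
    IsHolderFunctional η m m 1 (seqSum v m) where
  measurable := by
    unfold seqSum
    exact Finset.measurable_sum _ fun i _ => hv.measurable.comp (measurable_pi_apply i)
  congr x y h := Finset.sum_congr rfl fun i hi => by rw [h i (Finset.mem_range.1 hi)]
  bound x := hv.abs_seqSum_le m x
  holder x l y := by
    rw [one_mul]
    exact hv.abs_seqSum_sub_update_le m x l y

theorem measurable_iteratedSum {M : Type*} [MeasurableSpace M] {v w : M → ℝ}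
    (hv : Measurable v) (hw : Measurable w) (m : ℕ) :
    Measurable (iteratedSum v w m) := by
  unfold iteratedSum
  exact Finset.measurable_sum _ fun j _ => Finset.measurable_sum _ fun i _ =>
    (hv.comp (measurable_pi_apply i)).mul (hw.comp (measurable_pi_apply j))

theorem abs_iteratedSum_sub_update_le (hv : IsUnitHolder η v) (hw : IsUnitHolder η w) (m : ℕ)
    (x : ℕ → M) (l : ℕ) (y : M) :
    |iteratedSum v w m x - iteratedSum v w m (update x l y)| ≤ 2 * m * dist (x l) y ^ η := by
  have hd : 0 ≤ dist (x l) y ^ η := by positivity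
  have key : |iteratedSum v w m x - iteratedSum v w m (update x l y)| ≤
      ∑ j ∈ Finset.range m,
        (dist (x l) y ^ η + m * if j = l then dist (x l) y ^ η else 0) := by
    have e : ∀ z : ℕ → M, iteratedSum v w m z =
        ∑ j ∈ Finset.range m, seqSum v j z * w (z j) := by
      intro z
      simp only [iteratedSum, seqSum, Finset.sum_mul]
    rw [e, e, ← Finset.sum_sub_distrib]
    refine (Finset.abs_sum_le_sum_abs _ _).trans (Finset.sum_le_sum fun j hj => ?_)
    have e1 : seqSum v j x * w (x j) - seqSum v j (update x l y) * w (update x l y j) =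
        (seqSum v j x - seqSum v j (update x l y)) * w (x j) +
          seqSum v j (update x l y) * (w (x j) - w (update x l y j)) := by ring
    rw [e1]
    refine (abs_add_le _ _).trans ?_
    rw [abs_mul, abs_mul]
    have hjm : (j : ℝ) ≤ m := by exact_mod_cast (Finset.mem_range.1 hj).le
    have h1 := hv.abs_seqSum_sub_update_le j x l y
    have h2 := hw.bound (x j)
    have h3 := (hv.abs_seqSum_le j (update x l y)).trans hjm
    have h4 := hw.abs_sub_update_le x l y j
    calc _ ≤ dist (x l) y ^ η * 1 + m * (if j = l then dist (x l) y ^ η else 0) := by gcongr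
      _ = _ := by rw [mul_one]
  refine key.trans ?_
  rw [Finset.sum_add_distrib, ← Finset.mul_sum, Finset.sum_ite_eq', Finset.sum_const,
    Finset.card_range, nsmul_eq_mul]
  have : (if l ∈ Finset.range m then dist (x l) y ^ η else 0) ≤ dist (x l) y ^ η := by
    split_ifs
    · exact le_rfl
    · exact hd
  have hm : (0 : ℝ) ≤ m := by positivity
  nlinarith

theorem isHolderFunctional_iteratedSum_sub (hv : IsUnitHolder η v) (hw : IsUnitHolder η w)
    (m : ℕ) {c : ℝ} (hc : |c| ≤ (m : ℝ) ^ 2) :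
    IsHolderFunctional η m (2 * (m : ℝ) ^ 2) (2 * m) (fun x => iteratedSum v w m x - c) where
  measurable := (measurable_iteratedSum hv.measurable hw.measurable m).sub_const c
  congr x y h := by
    have : iteratedSum v w m x = iteratedSum v w m y := by
      refine Finset.sum_congr rfl fun j hj => Finset.sum_congr rfl fun i hi => ?_
      rw [Finset.mem_range] at hi hj
      rw [h i (hi.trans hj), h j hj]
    rw [this]
  bound x := by
    refine (abs_sub _ _).trans ?_
    linarith [abs_iteratedSum_le hv hw m x]
  holder x l y := by
    rw [sub_sub_sub_cancel_right]
    exact abs_iteratedSum_sub_update_le hv hw m x l y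

variable {μ : Measure M} {T : M → M}

theorem abs_integral_mul_iterate_le {γ C₀ : ℝ} (hT : MeasurePreserving T μ μ)
    (hF : FunctionalCorrelationBoundWith μ T η γ C₀)
    (hv : IsUnitHolder η v) (hw : IsUnitHolder η w) (hv0 : ∫ x, v x ∂μ = 0) {i j : ℕ}
    (hij : i < j) :
    |∫ x, v (T^[i] x) * w (T^[j] x) ∂μ| ≤ 3 * C₀ * ((j : ℝ) - i) ^ (-γ) := by
  have hn : Monotone fun k : ℕ => if k = 0 then i else j := by
    intro a b hab
    simp only
    split_ifs <;> omega
  have h := hF 2 1 (by norm_num) (fun k => if k = 0 then i else j) hn (by simpa using hij)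
    (fun x => v (x 0) * w (x 1))
    ((hv.measurable.comp (measurable_pi_apply 0)).mul (hw.measurable.comp (measurable_pi_apply 1)))
    1 (by norm_num)
    (fun x => by
      rw [abs_mul]
      exact mul_le_one₀ (hv.bound _) (abs_nonneg _) (hw.bound _))
    (fun _ => 1) (fun _ => by norm_num)
    (fun l x y => by
      fin_cases l
      · have e : v (x 0) * w (x 1) - v y * w (x 1) = (v (x 0) - v y) * w (x 1) := by ring
        simp only [Fin.zero_eta, update_self, ne_eq, one_ne_zero, not_false_eq_true, update_of_ne]
        rw [e, abs_mul, mul_comm]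
        exact mul_le_mul (hw.bound _) (hv.holder _ _) (abs_nonneg _) (by norm_num)
      · have e : v (x 0) * w (x 1) - v (x 0) * w y = v (x 0) * (w (x 1) - w y) := by ring
        simp only [Fin.mk_one, update_self, ne_eq, zero_ne_one, not_false_eq_true, update_of_ne]
        rw [e, abs_mul]
        exact mul_le_mul (hv.bound _) (hw.holder _ _) (abs_nonneg _) (by norm_num))
  have e0 : ∫ x, v (T^[i] x) ∂μ = 0 := by
    rw [integral_comp_iterate hT hv.measurable, hv0]
  simp only [Fin.coe_ofNat_eq_mod, Nat.zero_mod, Nat.one_mod, if_true, one_ne_zero, if_false,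
    zero_lt_one, lt_irrefl, integral_const_mul, integral_mul_const, e0, zero_mul, sub_zero,
    Fin.sum_univ_two, tsub_self] at h
  refine h.trans (le_of_eq ?_)
  ring

theorem exists_abs_integral_iteratedSum_le [IsProbabilityMeasure μ] {γ C₀ : ℝ} (hγ : 1 < γ)
    (hT : MeasurePreserving T μ μ) (hF : FunctionalCorrelationBoundWith μ T η γ C₀)
    (hC₀ : 0 ≤ C₀) :
    ∃ C : ℝ, 0 ≤ C ∧ ∀ v w : M → ℝ, IsUnitHolder η v → IsUnitHolder η w → ∫ x, v x ∂μ = 0 →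
      ∀ m : ℕ, |∫ x, iteratedSum v w m (orbitSeq T x) ∂μ| ≤ C * m := by
  have hs : Summable fun n : ℕ => (n : ℝ) ^ (-γ) := Real.summable_nat_rpow.2 (by linarith)
  refine ⟨3 * C₀ * ∑' n : ℕ, (n : ℝ) ^ (-γ), ?_, fun v w hv hw hv0 m => ?_⟩
  · have : 0 ≤ ∑' n : ℕ, (n : ℝ) ^ (-γ) := tsum_nonneg fun n => by positivity
    positivity
  have hI : ∀ i j : ℕ, Integrable (fun x => v (T^[i] x) * w (T^[j] x)) μ := by
    intro i j
    refine Integrable.of_bound (C := 1) ((hv.measurable.comp (hT.iterate i).measurable).mul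
      (hw.measurable.comp (hT.iterate j).measurable)).aestronglyMeasurable (ae_of_all _ fun x => ?_)
    rw [Real.norm_eq_abs, abs_mul]
    exact mul_le_one₀ (hv.bound _) (abs_nonneg _) (hw.bound _)
  simp only [iteratedSum, orbitSeq]
  rw [integral_finsetSum _ fun j _ => integrable_finsetSum _ fun i _ => hI i j]
  refine (Finset.abs_sum_le_sum_abs _ _).trans ?_
  have hj : ∀ j ∈ Finset.range m, |∫ x, ∑ i ∈ Finset.range j, v (T^[i] x) * w (T^[j] x) ∂μ| ≤
      3 * C₀ * ∑' n : ℕ, (n : ℝ) ^ (-γ) := by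
    intro j _
    rw [integral_finsetSum _ fun i _ => hI i j]
    refine (Finset.abs_sum_le_sum_abs _ _).trans ?_
    refine (Finset.sum_le_sum fun i hi => abs_integral_mul_iterate_le hT hF hv hw hv0
      (Finset.mem_range.1 hi)).trans ?_
    rw [← Finset.mul_sum]
    refine mul_le_mul_of_nonneg_left ?_ (by positivity)
    calc ∑ i ∈ Finset.range j, ((j : ℝ) - i) ^ (-γ)
        = ∑ i ∈ Finset.range j, ((i + 1 : ℕ) : ℝ) ^ (-γ) := by
          rw [← Finset.sum_range_reflect]
          refine Finset.sum_congr rfl fun i hi => ?_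
          have := Finset.mem_range.1 hi
          rw [Nat.sub_sub, Nat.cast_sub (by omega)]
          congr 1
          push_cast
          ring
      _ ≤ ∑ i ∈ Finset.range (j + 1), (i : ℝ) ^ (-γ) := by
          rw [Finset.sum_range_succ']
          have : (0 : ℝ) ≤ ((0 : ℕ) : ℝ) ^ (-γ) := by positivity
          linarith
      _ ≤ _ := hs.sum_le_tsum _ fun i _ => by positivity
  refine (Finset.sum_le_sum hj).trans (le_of_eq ?_)
  rw [Finset.sum_const, Finset.card_range, nsmul_eq_mul]
  ring

end Observables

theorem abs_add_rpow_le_two_rpow_mul {p : ℝ} (hp : 0 ≤ p) (a b : ℝ) :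
    |a + b| ^ p ≤ 2 ^ p * (|a| ^ p + |b| ^ p) := by
  wlog hab : |b| ≤ |a| generalizing a b
  · rw [add_comm a b, add_comm (|a| ^ p)]
    exact this b a (le_of_not_ge hab)
  have h1 : |a + b| ≤ 2 * |a| := (abs_add_le _ _).trans (by linarith)
  have h2 : |a + b| ^ p ≤ 2 ^ p * |a| ^ p := by
    rw [← Real.mul_rpow (by norm_num) (abs_nonneg _)]
    exact Real.rpow_le_rpow (abs_nonneg _) h1 hp
  have : 0 ≤ (2 : ℝ) ^ p * |b| ^ p := by positivity
  linarith

section Blocks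

variable {M : Type*} [MetricSpace M] [MeasurableSpace M] {η : ℝ}
  {μ : Measure M} [IsProbabilityMeasure μ] {T : M → M}

theorem integral_abs_sum_blocks_le (hT : MeasurePreserving T μ μ) {p : ℝ} (hp : 0 ≤ p)
    {m : ℕ} {Q H : ℝ} {B : (ℕ → M) → ℝ} (hB : IsHolderFunctional η m Q H B) (k : ℕ) :
    ∫ x, |∑ j ∈ Finset.range (2 * k), B (orbitSeq T (T^[j * m] x))| ^ p ∂μ ≤
      2 ^ p * (2 * ∫ x, |spacedSum m B k (orbitSeq T x)| ^ p ∂μ) := by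
  have mb : ∀ s, Measurable fun x => B (orbitSeq T (T^[s] x)) := fun s =>
    (hB.measurable.comp (measurable_orbitSeq hT.measurable)).comp (hT.iterate s).measurable
  have hbound : ∀ (s : ℕ → ℕ) (x : M), |∑ i ∈ Finset.range k, B (orbitSeq T (T^[s i] x))| ≤
      k * Q := by
    intro s x
    refine (Finset.abs_sum_le_sum_abs _ _).trans ?_
    refine (Finset.sum_le_sum fun i _ => hB.bound _).trans ?_
    simp
  set f : M → ℝ := fun x => ∑ i ∈ Finset.range k, B (orbitSeq T (T^[2 * i * m] x)) with hf
  set g : M → ℝ := fun x => ∑ i ∈ Finset.range k, B (orbitSeq T (T^[(2 * i + 1) * m] x)) with hg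
  have mf : Measurable f := Finset.measurable_sum _ fun i _ => mb _
  have mg : Measurable g := Finset.measurable_sum _ fun i _ => mb _
  have iF : Integrable (fun x => |f x| ^ p) μ := integrable_abs_rpow mf (hbound _) hp
  have iG : Integrable (fun x => |g x| ^ p) μ := integrable_abs_rpow mg (hbound _) hp
  have hgs : ∀ x, spacedSum m B k (orbitSeq T x) = g x := by
    intro x
    simp only [spacedSum, hg, orbitSeq_add]
  have hgf : ∀ x, g x = f (T^[m] x) := by
    intro x
    simp only [hf, hg]
    refine Finset.sum_congr rfl fun i _ => ?_
    rw [← iterate_add_apply, add_one_mul]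
  have hsum : ∀ (j : ℕ) (x : M), ∑ i ∈ Finset.range (2 * j), B (orbitSeq T (T^[i * m] x)) =
      ∑ i ∈ Finset.range j, B (orbitSeq T (T^[2 * i * m] x)) +
        ∑ i ∈ Finset.range j, B (orbitSeq T (T^[(2 * i + 1) * m] x)) := by
    intro j x
    induction j with
    | zero => simp
    | succ j ih =>
      rw [mul_add_one, Finset.sum_range_succ, Finset.sum_range_succ, ih,
        Finset.sum_range_succ, Finset.sum_range_succ]
      ring
  have hsplit : ∀ x, ∑ j ∈ Finset.range (2 * k), B (orbitSeq T (T^[j * m] x)) = f x + g x :=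
    hsum k
  have hfg : ∫ x, |f x| ^ p ∂μ = ∫ x, |g x| ^ p ∂μ := by
    simp only [hgf]
    exact (integral_comp_iterate hT (mf.abs.pow_const p) m).symm
  simp only [hsplit, hgs]
  calc ∫ x, |f x + g x| ^ p ∂μ ≤ ∫ x, 2 ^ p * (|f x| ^ p + |g x| ^ p) ∂μ :=
        integral_mono_of_nonneg (ae_of_all _ fun x => by positivity)
          ((iF.add iG).const_mul _) (ae_of_all _ fun x => abs_add_rpow_le_two_rpow_mul hp _ _)
    _ = _ := by
      rw [integral_const_mul, integral_add iF iG, hfg]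
      ring

theorem integral_seqSum_orbitSeq_eq_zero (hT : MeasurePreserving T μ μ) {v : M → ℝ}
    (hv : IsUnitHolder η v) (hv0 : ∫ x, v x ∂μ = 0) (m : ℕ) :
    ∫ x, seqSum v m (orbitSeq T x) ∂μ = 0 := by
  simp only [seqSum, orbitSeq]
  rw [integral_finsetSum]
  · exact Finset.sum_eq_zero fun i _ => by rw [integral_comp_iterate hT hv.measurable, hv0]
  · intro i _
    exact Integrable.of_bound
      (hv.measurable.comp (hT.iterate i).measurable).aestronglyMeasurable 1
      (ae_of_all _ fun x => hv.bound _)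

theorem exists_integral_seqSum_sq_le {γ C₀ : ℝ} (hγ : 1 < γ)
    (hT : MeasurePreserving T μ μ) (hF : FunctionalCorrelationBoundWith μ T η γ C₀)
    (hC₀ : 0 ≤ C₀) :
    ∃ C : ℝ, 0 < C ∧ ∀ v : M → ℝ, IsUnitHolder η v → ∫ x, v x ∂μ = 0 →
      ∀ m : ℕ, ∫ x, seqSum v m (orbitSeq T x) ^ 2 ∂μ ≤ C * m := by
  obtain ⟨C, hC, h⟩ := exists_abs_integral_iteratedSum_le hγ hT hF hC₀
  refine ⟨1 + 2 * C, by positivity, fun v hv hv0 m => ?_⟩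
  have iI : Integrable (fun x => iteratedSum v v m (orbitSeq T x)) μ :=
    Integrable.of_bound ((measurable_iteratedSum hv.measurable hv.measurable m).comp
      (measurable_orbitSeq hT.measurable)).aestronglyMeasurable ((m : ℝ) ^ 2)
      (ae_of_all _ fun x => abs_iteratedSum_le hv hv m _)
  have hle : ∀ x, seqSum v m (orbitSeq T x) ^ 2 ≤
      m + 2 * iteratedSum v v m (orbitSeq T x) := by
    intro x
    rw [seqSum_sq]
    have : ∑ j ∈ Finset.range m, v (orbitSeq T x j) ^ 2 ≤ ∑ j ∈ Finset.range m, (1 : ℝ) := by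
      refine Finset.sum_le_sum fun j _ => ?_
      rw [sq_le_one_iff_abs_le_one]
      exact hv.bound _
    simp only [Finset.sum_const, Finset.card_range, nsmul_eq_mul, mul_one] at this
    linarith
  calc ∫ x, seqSum v m (orbitSeq T x) ^ 2 ∂μ
      ≤ ∫ x, ((m : ℝ) + 2 * iteratedSum v v m (orbitSeq T x)) ∂μ :=
        integral_mono_of_nonneg (ae_of_all _ fun x => sq_nonneg _)
          ((integrable_const _).add (iI.const_mul 2)) (ae_of_all _ hle)
    _ = m + 2 * ∫ x, iteratedSum v v m (orbitSeq T x) ∂μ := by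
        rw [integral_add (integrable_const _) (iI.const_mul 2), integral_const_mul]
        simp
    _ ≤ (1 + 2 * C) * m := by
        have := (abs_le.1 (h v v hv hv hv0 m)).2
        linarith

theorem exists_rpow_one_sub_le {γ δ : ℝ} (hγ : 1 < γ) (hδ : 0 < δ) :
    ∃ k : ℕ, 1 ≤ k ∧ (k : ℝ) ^ (1 - γ) ≤ δ := by
  have h : Filter.Tendsto (fun k : ℕ => (k : ℝ) ^ (-(γ - 1))) Filter.atTop (nhds 0) :=
    (tendsto_rpow_neg_atTop (by linarith)).comp tendsto_natCast_atTop_atTop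
  obtain ⟨k, h1, h2⟩ :=
    ((h.eventually (ge_mem_nhds hδ)).and (Filter.eventually_ge_atTop 1)).exists
  exact ⟨k, h2, by rwa [neg_sub] at h1⟩

theorem natCast_rpow_le_of_mul_le {k m n : ℕ} {γ : ℝ} (hγ : 0 ≤ γ) (hk : 1 ≤ k)
    (h : k * m ≤ n) : (m : ℝ) ^ γ ≤ (k : ℝ) ^ (-γ) * (n : ℝ) ^ γ := by
  have hk' : (0 : ℝ) < k := by exact_mod_cast hk
  have h' : (k : ℝ) * m ≤ n := by exact_mod_cast h
  rw [Real.rpow_neg hk'.le, ← Real.inv_rpow hk'.le, ← Real.mul_rpow (by positivity) (by positivity)]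
  refine Real.rpow_le_rpow (by positivity) ?_ hγ
  rw [inv_mul_eq_div, le_div_iff₀ hk']
  linarith

theorem exists_integral_abs_seqSum_rpow_le {γ C₀ : ℝ} (hγ : 1 < γ)
    (hT : MeasurePreserving T μ μ) (hF : FunctionalCorrelationBoundWith μ T η γ C₀)
    (hC₀ : 0 ≤ C₀) :
    ∃ C : ℝ, 0 < C ∧ ∀ v : M → ℝ, IsUnitHolder η v → ∫ x, v x ∂μ = 0 →
      ∀ n : ℕ, ∫ x, |seqSum v n (orbitSeq T x)| ^ (2 * γ) ∂μ ≤ C * (n : ℝ) ^ γ := by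
  obtain ⟨C₂, hC₂, hsq⟩ := exists_integral_seqSum_sq_le hγ hT hF hC₀
  obtain ⟨K, hK, hmom⟩ := exists_integral_abs_spacedSum_le_of_two_le (M := M) (η := η) (μ := μ)
    (T := T) (p := 2 * γ) (by linarith)
  set p := 2 * γ with hp
  have hp0 : 0 < p := by linarith
  have hP : (0 : ℝ) < 2 ^ p := by positivity
  obtain ⟨k, hk, hkδ⟩ := exists_rpow_one_sub_le hγ
    (δ := 1 / (12 * K * (2 ^ p * 2 ^ p))) (by positivity)
  have hk0 : (0 : ℝ) < k := by exact_mod_cast hk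
  set E := 3 * k * (C₀ * ((1 + 2 * p) * (k : ℝ) ^ p)) + (6 * K * C₂) ^ γ with hE
  have hE0 : 0 ≤ E := by positivity
  set D := 2 * (2 ^ p * (2 ^ p * (2 * E) + (2 * k) ^ p)) with hD
  have hkp : 0 < (2 * (k : ℝ)) ^ p := by positivity
  have hD0 : 0 < D := by positivity
  have hDk : (2 * (k : ℝ)) ^ p ≤ D := by
    have h1 : (1 : ℝ) ≤ 2 ^ p := Real.one_le_rpow (by norm_num) hp0.le
    have h2 : 0 ≤ (2 : ℝ) ^ p * (2 ^ p * (2 * E)) := by positivity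
    rw [hD]
    nlinarith
  refine ⟨D, hD0, fun v hv hv0 n => ?_⟩
  induction n using Nat.strong_induction_on with
  | _ n ih =>
  have mS : ∀ j, Measurable fun x => seqSum v j (orbitSeq T x) := fun j =>
    (hv.isHolderFunctional_seqSum j).measurable.comp (measurable_orbitSeq hT.measurable)
  rcases Nat.eq_zero_or_pos n with rfl | hn
  · simp [seqSum, Real.zero_rpow hp0.ne', Real.zero_rpow (by linarith : γ ≠ 0)]
  have hn1 : (1 : ℝ) ≤ n := by exact_mod_cast hn
  have hnγ : 1 ≤ (n : ℝ) ^ γ := Real.one_le_rpow hn1 (by linarith)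
  rcases lt_or_ge n (2 * k) with hnk | hnk
  · calc ∫ x, |seqSum v n (orbitSeq T x)| ^ p ∂μ ≤ ∫ _, (2 * (k : ℝ)) ^ p ∂μ := by
          refine integral_mono_of_nonneg (ae_of_all _ fun x => by positivity)
            (integrable_const _) (ae_of_all _ fun x => ?_)
          refine Real.rpow_le_rpow (abs_nonneg _) ((hv.abs_seqSum_le n _).trans ?_) hp0.le
          exact_mod_cast hnk.le
      _ = (2 * (k : ℝ)) ^ p := by simp
      _ ≤ D * (n : ℝ) ^ γ := by nlinarith
  · set m := n / (2 * k) with hm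
    have hm1 : 1 ≤ m := (Nat.one_le_div_iff (by omega)).2 hnk
    have hnm : 2 * k * m + n % (2 * k) = n := Nat.div_add_mod n (2 * k)
    have hr : n % (2 * k) < 2 * k := Nat.mod_lt _ (by omega)
    set r := n % (2 * k)
    have hkm : k * m ≤ n := by nlinarith
    have hmn : m < n := by nlinarith
    have hB := hv.isHolderFunctional_seqSum m
    have hm0 : (0 : ℝ) < m := by exact_mod_cast hm1
    have hspaced := hmom hT hF hC₀ hm1 hB zero_le_one (by rw [one_mul])
      (integral_seqSum_orbitSeq_eq_zero hT hv hv0 m) (ih m hmn) (β₂ := C₂ * m) (by positivity)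
      (hsq v hv hv0 m) k hk
    have hblocks := integral_abs_sum_blocks_le hT hp0.le hB k
    set S := ∫ x, |spacedSum m (seqSum v m) k (orbitSeq T x)| ^ p ∂μ
    have hmγ := natCast_rpow_le_of_mul_le (γ := γ) (by linarith) hk hkm
    have hmle : (m : ℝ) ^ γ ≤ (n : ℝ) ^ γ :=
      Real.rpow_le_rpow hm0.le (by exact_mod_cast hmn.le) (by linarith)
    have hS : S ≤ E * (n : ℝ) ^ γ + 3 * K * D * (k : ℝ) ^ (1 - γ) * (n : ℝ) ^ γ := by
      have e1 : (m : ℝ) ^ (-γ) * ((1 + 2 * p) * (k * m) ^ p) =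
          ((1 + 2 * p) * (k : ℝ) ^ p) * (m : ℝ) ^ γ := by
        rw [Real.mul_rpow hk0.le hm0.le]
        have : (m : ℝ) ^ p = (m : ℝ) ^ γ * (m : ℝ) ^ γ := by
          rw [← Real.rpow_add hm0]; congr 1; rw [hp]; ring
        rw [this, Real.rpow_neg hm0.le]
        have : (m : ℝ) ^ γ ≠ 0 := by positivity
        field_simp
      have e2 : (6 * K * k * (C₂ * m)) ^ (p / 2) ≤ (6 * K * C₂) ^ γ * (n : ℝ) ^ γ := by
        rw [← Real.mul_rpow (by positivity) (by positivity), hp, mul_div_cancel_left₀ _ two_ne_zero]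
        refine Real.rpow_le_rpow (by positivity) ?_ (by linarith)
        have : (k : ℝ) * m ≤ n := by exact_mod_cast hkm
        calc 6 * K * k * (C₂ * m) = 6 * K * C₂ * (k * m) := by ring
          _ ≤ _ := by gcongr
      have e3 : (k : ℝ) * (m : ℝ) ^ γ ≤ (k : ℝ) ^ (1 - γ) * (n : ℝ) ^ γ := by
        have : (k : ℝ) ^ (1 - γ) = k * (k : ℝ) ^ (-γ) := by
          rw [sub_eq_add_neg, Real.rpow_add hk0, Real.rpow_one]
        rw [this, mul_assoc]
        gcongr
      have e4 : 3 * k * (C₀ * ((1 + 2 * p) * (k : ℝ) ^ p)) * (m : ℝ) ^ γ ≤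
          3 * k * (C₀ * ((1 + 2 * p) * (k : ℝ) ^ p)) * (n : ℝ) ^ γ := by gcongr
      have e5 : 3 * K * D * (k * (m : ℝ) ^ γ) ≤
          3 * K * D * ((k : ℝ) ^ (1 - γ) * (n : ℝ) ^ γ) := by gcongr
      rw [mul_assoc C₀, e1] at hspaced
      rw [hE]
      linarith
    have hdec : ∀ x, seqSum v n (orbitSeq T x) =
        ∑ j ∈ Finset.range (2 * k), seqSum v m (orbitSeq T (T^[j * m] x)) +
          seqSum v r (orbitSeq T (T^[2 * k * m] x)) := by
      intro x
      rw [← seqSum_mul_orbitSeq, ← seqSum_add_orbitSeq, hnm]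
    have iB : Integrable (fun x => |∑ j ∈ Finset.range (2 * k),
        seqSum v m (orbitSeq T (T^[j * m] x))| ^ p) μ := by
      simp only [← seqSum_mul_orbitSeq]
      exact integrable_abs_rpow (mS _) (fun x => hv.abs_seqSum_le _ _) hp0.le
    have hfinal : ∫ x, |seqSum v n (orbitSeq T x)| ^ p ∂μ ≤
        2 ^ p * (2 ^ p * (2 * S) + (2 * k) ^ p) := by
      calc ∫ x, |seqSum v n (orbitSeq T x)| ^ p ∂μ
          ≤ ∫ x, 2 ^ p * (|∑ j ∈ Finset.range (2 * k),
              seqSum v m (orbitSeq T (T^[j * m] x))| ^ p + (2 * k) ^ p) ∂μ := by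
            refine integral_mono_of_nonneg (ae_of_all _ fun x => by positivity)
              ((iB.add (integrable_const _)).const_mul _) (ae_of_all _ fun x => ?_)
            simp only [hdec]
            refine (abs_add_rpow_le_two_rpow_mul hp0.le _ _).trans ?_
            gcongr
            refine (hv.abs_seqSum_le r _).trans ?_
            exact_mod_cast hr.le
        _ = 2 ^ p * ((∫ x, |∑ j ∈ Finset.range (2 * k),
              seqSum v m (orbitSeq T (T^[j * m] x))| ^ p ∂μ) + (2 * k) ^ p) := by
            rw [integral_const_mul, integral_add iB (integrable_const _)]
            simp
        _ ≤ _ := by gcongr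
    refine hfinal.trans ?_
    have h1 : 2 ^ p * (2 ^ p * (2 * S) + (2 * k) ^ p) ≤
        2 ^ p * (2 ^ p * (2 * (E * (n : ℝ) ^ γ + 3 * K * D * (k : ℝ) ^ (1 - γ) * (n : ℝ) ^ γ)) +
          (2 * k) ^ p * (n : ℝ) ^ γ) := by
      gcongr
      exact le_mul_of_one_le_right hkp.le hnγ
    have h2 : 2 ^ p * (2 ^ p * (2 * (3 * K * D * (k : ℝ) ^ (1 - γ) * (n : ℝ) ^ γ))) ≤
        D / 2 * (n : ℝ) ^ γ := by
      have h3 : 12 * K * (2 ^ p * 2 ^ p) * (k : ℝ) ^ (1 - γ) ≤ 1 := by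
        rw [le_div_iff₀ (by positivity)] at hkδ
        linarith
      have h4 : 12 * K * (2 ^ p * 2 ^ p) * (k : ℝ) ^ (1 - γ) * (D / 2 * (n : ℝ) ^ γ) ≤
          1 * (D / 2 * (n : ℝ) ^ γ) := by gcongr
      linarith
    have h5 : 2 ^ p * (2 ^ p * (2 * (E * (n : ℝ) ^ γ)) + (2 * k) ^ p * (n : ℝ) ^ γ) =
        D / 2 * (n : ℝ) ^ γ := by
      rw [hD]; ring
    linarith

end Blocks

section Recursion

variable {M : Type*} [MetricSpace M] [MeasurableSpace M] {η : ℝ}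
  {μ : Measure M} [IsProbabilityMeasure μ] {T : M → M}

theorem exists_integral_abs_spacedSum_le {p : ℝ} (hp : 1 < p) :
    ∃ K : ℝ, 0 < K ∧ ∀ {γ C₀ : ℝ}, MeasurePreserving T μ μ →
      FunctionalCorrelationBoundWith μ T η γ C₀ → 0 ≤ C₀ →
      ∀ {m : ℕ} {Q H β : ℝ} {B : (ℕ → M) → ℝ}, 1 ≤ m → IsHolderFunctional η m Q H B →
      0 ≤ H → H * m ≤ Q → ∫ x, B (orbitSeq T x) ∂μ = 0 → 0 < β →
      ∫ x, |B (orbitSeq T x)| ^ p ∂μ ≤ β → ∀ k : ℕ, 1 ≤ k →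
      ∫ x, |spacedSum m B k (orbitSeq T x)| ^ p ∂μ ≤
        K * (k * (C₀ * (m : ℝ) ^ (-γ) * ((1 + 2 * p) * (k * Q) ^ p)) +
          (k + (k : ℝ) ^ (p / 2)) * β) := by
  rcases le_total p 2 with hp2 | hp2
  · obtain ⟨K, hK, h⟩ := exists_integral_abs_spacedSum_le_of_le_two (M := M) (η := η) (μ := μ)
      (T := T) hp hp2
    refine ⟨K, by linarith, fun {γ C₀} hT hF hC₀ {m Q H β B} hm hB hH hHQ hB0 hβ0 hβ k _ => ?_⟩
    have hQ : 0 ≤ Q := le_trans (by positivity) hHQ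
    refine (h hT hF hC₀ hm hB hH hHQ hB0 hβ k).trans ?_
    have hE0 : 0 ≤ (k : ℝ) * (C₀ * (m : ℝ) ^ (-γ) * ((1 + 2 * p) * (k * Q) ^ p)) := by positivity
    have h1 : 0 ≤ K * ((k : ℝ) ^ (p / 2) * β) := by positivity
    nlinarith
  · obtain ⟨K, hK, h⟩ := exists_integral_abs_spacedSum_le_of_two_le (M := M) (η := η) (μ := μ)
      (T := T) hp2
    refine ⟨3 * K + (12 * K) ^ (p / 2), by positivity,
      fun {γ C₀} hT hF hC₀ {m Q H β B} hm hB hH hHQ hB0 hβ0 hβ k hk => ?_⟩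
    have hQ : 0 ≤ Q := le_trans (by positivity) hHQ
    have hp0 : p ≠ 0 := by linarith
    have mB : Measurable fun x => B (orbitSeq T x) :=
      hB.measurable.comp (measurable_orbitSeq hT.measurable)
    have iB : Integrable (fun x => |B (orbitSeq T x)| ^ p) μ :=
      integrable_abs_rpow mB (fun x => hB.bound _) (by linarith)
    set l := β ^ (1 / p) with hl
    have hl0 : 0 < l := by positivity
    have hlp : l ^ p = β := by
      rw [hl, ← Real.rpow_mul hβ0.le, one_div_mul_cancel hp0, Real.rpow_one]
    have hl2 : β * l ^ (2 - p) = l ^ 2 := by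
      rw [← hlp, ← Real.rpow_add hl0, ← Real.rpow_natCast]
      congr 1
      push_cast
      ring
    have hβ₂ : ∫ x, B (orbitSeq T x) ^ 2 ∂μ ≤ 2 * l ^ 2 := by
      calc ∫ x, B (orbitSeq T x) ^ 2 ∂μ
          ≤ ∫ x, (l ^ 2 + |B (orbitSeq T x)| ^ p * l ^ (2 - p)) ∂μ :=
            integral_mono_of_nonneg (ae_of_all _ fun x => sq_nonneg _)
              ((integrable_const _).add (iB.mul_const _))
              (ae_of_all _ fun x => sq_le_add_rpow hp2 hl0)
        _ = l ^ 2 + (∫ x, |B (orbitSeq T x)| ^ p ∂μ) * l ^ (2 - p) := by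
            rw [integral_add (integrable_const _) (iB.mul_const _), integral_mul_const]
            simp
        _ ≤ l ^ 2 + β * l ^ (2 - p) := by gcongr
        _ = 2 * l ^ 2 := by rw [hl2]; ring
    refine (h hT hF hC₀ hm hB hH hHQ hB0 hβ (by positivity) hβ₂ k hk).trans ?_
    have e : (6 * K * k * (2 * l ^ 2)) ^ (p / 2) = (12 * K) ^ (p / 2) * (k : ℝ) ^ (p / 2) * β := by
      have e1 : 6 * K * k * (2 * l ^ 2) = 12 * K * k * l ^ 2 := by ring
      have e2 : (l ^ 2) ^ (p / 2) = β := by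
        rw [← Real.rpow_natCast, ← Real.rpow_mul hl0.le, ← hlp]
        congr 1
        push_cast
        ring
      rw [e1, Real.mul_rpow (by positivity) (by positivity),
        Real.mul_rpow (by positivity) (by positivity), e2]
    rw [e]
    set E := C₀ * (m : ℝ) ^ (-γ) * ((1 + 2 * p) * (k * Q) ^ p)
    have hE0 : 0 ≤ (k : ℝ) * E := by positivity
    set L := (12 * K) ^ (p / 2)
    have hL : 0 < L := by positivity
    have h1 : 0 ≤ K * ((k : ℝ) ^ (p / 2) * β) := by positivity
    have h2 : 0 ≤ L * ((k : ℝ) * β) := by positivity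
    have h3 : 0 ≤ L * ((k : ℝ) * E) := by positivity
    have h4 : 0 ≤ (K - 1) * ((k : ℝ) * E) := mul_nonneg (by linarith) hE0
    nlinarith

theorem abs_mul_rpow_le_add (a b γ : ℝ) :
    |a * b| ^ γ ≤ |a| ^ (2 * γ) + |b| ^ (2 * γ) := by
  have h : ∀ t : ℝ, |t| ^ (2 * γ) = (|t| ^ γ) ^ 2 := fun t => by
    rw [mul_comm, Real.rpow_mul (abs_nonneg _), Real.rpow_two]
  rw [abs_mul, Real.mul_rpow (abs_nonneg _) (abs_nonneg _), h, h]
  nlinarith [two_mul_le_add_sq (|a| ^ γ) (|b| ^ γ), sq_nonneg (|a| ^ γ), sq_nonneg (|b| ^ γ)]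

theorem exists_integral_abs_sum_seqSum_mul_le {γ C₀ : ℝ} (hγ : 1 < γ)
    (hT : MeasurePreserving T μ μ) (hF : FunctionalCorrelationBoundWith μ T η γ C₀)
    (hC₀ : 0 ≤ C₀) :
    ∃ C : ℝ, 0 < C ∧ ∀ v w : M → ℝ, IsUnitHolder η v → IsUnitHolder η w →
      ∫ x, v x ∂μ = 0 → ∫ x, w x ∂μ = 0 → ∀ J m n : ℕ, 1 ≤ J → J * m ≤ n →
      ∫ x, |∑ j ∈ Finset.range J, seqSum v (j * m) (orbitSeq T x) *
        seqSum w m (orbitSeq T (T^[j * m] x))| ^ γ ∂μ ≤ C * (J : ℝ) ^ γ * (n : ℝ) ^ γ := by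
  obtain ⟨C, hC, h⟩ := exists_integral_abs_seqSum_rpow_le hγ hT hF hC₀
  refine ⟨2 * C, by positivity, fun v w hv hw hv0 hw0 J m n hJ hn => ?_⟩
  have hJ0 : (0 : ℝ) < J := by exact_mod_cast hJ
  have hmono : ∀ i : ℕ, i ≤ n → C * (i : ℝ) ^ γ ≤ C * (n : ℝ) ^ γ := fun i hi => by
    have : (i : ℝ) ≤ n := by exact_mod_cast hi
    gcongr
  have mS : ∀ {u : M → ℝ}, IsUnitHolder η u → ∀ i s : ℕ,
      Measurable fun x => seqSum u i (orbitSeq T (T^[s] x)) := fun hu i s =>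
    ((hu.isHolderFunctional_seqSum i).measurable.comp (measurable_orbitSeq hT.measurable)).comp
      (hT.iterate s).measurable
  have iS : ∀ {u : M → ℝ}, IsUnitHolder η u → ∀ i s : ℕ,
      Integrable (fun x => |seqSum u i (orbitSeq T (T^[s] x))| ^ (2 * γ)) μ := fun hu i s =>
    integrable_abs_rpow (mS hu i s) (fun x => hu.abs_seqSum_le _ _) (by linarith)
  have hterm : ∀ j ∈ Finset.range J, ∫ x, (|seqSum v (j * m) (orbitSeq T x)| ^ (2 * γ) +
      |seqSum w m (orbitSeq T (T^[j * m] x))| ^ (2 * γ)) ∂μ ≤ 2 * (C * (n : ℝ) ^ γ) := by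
    intro j hj
    rw [Finset.mem_range] at hj
    have e := integral_comp_iterate hT (f := fun x => |seqSum w m (orbitSeq T x)| ^ (2 * γ))
      ((mS hw m 0).abs.pow_const (2 * γ)) (j * m)
    have e2 := integral_add (iS hv (j * m) 0) (iS hw m (j * m))
    simp only [iterate_zero, id_eq] at e e2
    rw [e2, e]
    have h1 := (h v hv hv0 (j * m)).trans
      (hmono _ ((Nat.mul_le_mul_right m hj.le).trans hn))
    have h2 := (h w hw hw0 m).trans (hmono _ ((Nat.le_mul_of_pos_left m hJ).trans hn))
    linarith
  have hpt : ∀ x, |∑ j ∈ Finset.range J, seqSum v (j * m) (orbitSeq T x) *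
      seqSum w m (orbitSeq T (T^[j * m] x))| ^ γ ≤ (J : ℝ) ^ (γ - 1) *
        ∑ j ∈ Finset.range J, (|seqSum v (j * m) (orbitSeq T x)| ^ (2 * γ) +
          |seqSum w m (orbitSeq T (T^[j * m] x))| ^ (2 * γ)) := by
    intro x
    refine (Real.rpow_le_rpow (abs_nonneg _) (Finset.abs_sum_le_sum_abs _ _)
      (by linarith)).trans ?_
    have := Real.rpow_sum_le_const_mul_sum_rpow (Finset.range J)
      (fun j => seqSum v (j * m) (orbitSeq T x) * seqSum w m (orbitSeq T (T^[j * m] x))) hγ.le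
    rw [Finset.card_range] at this
    refine this.trans ?_
    gcongr with j _
    exact abs_mul_rpow_le_add _ _ _
  have iT : ∀ j ∈ Finset.range J, Integrable (fun x =>
      |seqSum v (j * m) (orbitSeq T x)| ^ (2 * γ) +
        |seqSum w m (orbitSeq T (T^[j * m] x))| ^ (2 * γ)) μ := fun j _ =>
    (iS hv (j * m) 0).add (iS hw m (j * m))
  refine (integral_mono_of_nonneg (ae_of_all _ fun x => by positivity)
    ((integrable_finsetSum _ iT).const_mul _) (ae_of_all _ hpt)).trans ?_
  rw [integral_const_mul, integral_finsetSum _ iT]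
  calc (J : ℝ) ^ (γ - 1) * ∑ j ∈ Finset.range J, _
      ≤ (J : ℝ) ^ (γ - 1) * ∑ j ∈ Finset.range J, 2 * (C * (n : ℝ) ^ γ) :=
        mul_le_mul_of_nonneg_left (Finset.sum_le_sum hterm) (by positivity)
    _ = _ := by
      rw [Real.rpow_sub_one hJ0.ne']
      simp only [Finset.sum_const, Finset.card_range, nsmul_eq_mul]
      field_simp

theorem exists_integral_abs_iteratedSum_rpow_le {γ : ℝ} (hγ : 1 < γ)
    (hT : MeasurePreserving T μ μ) (hFCB : FunctionalCorrelationBound μ T η γ) :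
    ∃ C : ℝ, 0 < C ∧ ∀ v w : M → ℝ, IsUnitHolder η v → IsUnitHolder η w →
      ∫ x, v x ∂μ = 0 → ∫ x, w x ∂μ = 0 → ∀ D : ℝ, 0 < D → ∀ k : ℕ, 1 ≤ k →
      ∀ n : ℕ, 2 * k ≤ n →
      (∀ m : ℕ, 1 ≤ m → m < n →
        ∫ x, |iteratedSum v w m (orbitSeq T x)| ^ γ ∂μ ≤ (D * m) ^ γ) →
      ∫ x, |iteratedSum v w n (orbitSeq T x)| ^ γ ∂μ ≤
        C * ((k : ℝ) ^ γ + ((k : ℝ) ^ (1 - γ) + (k : ℝ) ^ (-(γ / 2))) * D ^ γ) *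
          (n : ℝ) ^ γ := by
  obtain ⟨C₀, hC₀', hF⟩ := hFCB
  have hC₀ := hC₀'.le
  obtain ⟨c₀, hc₀, hmean⟩ := exists_abs_integral_iteratedSum_le hγ hT hF hC₀
  obtain ⟨Cx, hCx, hcross⟩ := exists_integral_abs_sum_seqSum_mul_le hγ hT hF hC₀
  obtain ⟨K, hK, hmom⟩ := exists_integral_abs_spacedSum_le (M := M) (η := η) (μ := μ)
    (T := T) hγ
  have hγ0 : 0 < γ := by linarith
  set L := C₀ * (1 + 2 * γ) + 2 ^ γ * c₀ ^ γ * 2 + 2 ^ γ with hL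
  set P : ℝ := 2 ^ γ with hP
  have hP0 : 0 < P := by positivity
  refine ⟨P * (P * (2 * (K * L)) + P * (Cx * P + (c₀ + 4) ^ γ)), by positivity,
    fun v w hv hw hv0 hw0 D hD k hk n hn hind => ?_⟩
  have hk0 : (0 : ℝ) < k := by exact_mod_cast hk
  have hk1 : (1 : ℝ) ≤ k := by exact_mod_cast hk
  set m := n / (2 * k) with hm
  have hm1 : 1 ≤ m := (Nat.one_le_div_iff (by omega)).2 hn
  have hnm : 2 * k * m + n % (2 * k) = n := Nat.div_add_mod n (2 * k)
  have hr : n % (2 * k) < 2 * k := Nat.mod_lt _ (by omega)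
  set r := n % (2 * k)
  have hm0 : (0 : ℝ) < m := by exact_mod_cast hm1
  have hkm : k * m ≤ n := by nlinarith
  have h2km : 2 * k * m ≤ n := by omega
  have hmn : m < n := by nlinarith
  have hn0 : (0 : ℝ) < n := by exact_mod_cast hm1.trans hmn.le
  have h2km' : 2 * (k : ℝ) * m ≤ n := by exact_mod_cast h2km
  have hrn : (r : ℝ) ≤ n := by exact_mod_cast (by omega : r ≤ n)
  have hrk : (r : ℝ) ≤ 2 * k := by exact_mod_cast hr.le
  have mI : ∀ i s : ℕ, Measurable fun x => iteratedSum v w i (orbitSeq T (T^[s] x)) := fun i s =>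
    ((measurable_iteratedSum hv.measurable hw.measurable i).comp
      (measurable_orbitSeq hT.measurable)).comp (hT.iterate s).measurable
  have iI : Integrable (fun x => iteratedSum v w m (orbitSeq T x)) μ :=
    Integrable.of_bound (mI m 0).aestronglyMeasurable ((m : ℝ) ^ 2)
      (ae_of_all _ fun x => abs_iteratedSum_le hv hw m _)
  set c := ∫ x, iteratedSum v w m (orbitSeq T x) ∂μ with hc
  have hcm : |c| ≤ c₀ * m := hmean v w hv hw hv0 m
  have hcm2 : |c| ≤ (m : ℝ) ^ 2 := by
    have := norm_integral_le_of_norm_le_const (μ := μ)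
      (f := fun x => iteratedSum v w m (orbitSeq T x))
      (ae_of_all μ fun x => abs_iteratedSum_le hv hw m (orbitSeq T x))
    simpa using this
  have hB := isHolderFunctional_iteratedSum_sub hv hw m hcm2
  have hB0 : ∫ x, (iteratedSum v w m (orbitSeq T x) - c) ∂μ = 0 := by
    rw [integral_sub iI (integrable_const _)]
    simp [hc]
  have iIγ : Integrable (fun x => |iteratedSum v w m (orbitSeq T x)| ^ γ) μ :=
    integrable_abs_rpow (mI m 0) (fun x => abs_iteratedSum_le hv hw m _) hγ0.le
  have hβ : ∫ x, |iteratedSum v w m (orbitSeq T x) - c| ^ γ ∂μ ≤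
      P * (D ^ γ + c₀ ^ γ) * (m : ℝ) ^ γ := by
    calc ∫ x, |iteratedSum v w m (orbitSeq T x) - c| ^ γ ∂μ
        ≤ ∫ x, P * (|iteratedSum v w m (orbitSeq T x)| ^ γ + (c₀ * m) ^ γ) ∂μ := by
          refine integral_mono_of_nonneg (ae_of_all _ fun x => by positivity)
            ((iIγ.add (integrable_const _)).const_mul _) (ae_of_all _ fun x => ?_)
          simp only [sub_eq_add_neg]
          refine (abs_add_rpow_le_two_rpow_mul hγ0.le _ _).trans ?_
          rw [abs_neg]
          gcongr
      _ = P * ((∫ x, |iteratedSum v w m (orbitSeq T x)| ^ γ ∂μ) + (c₀ * m) ^ γ) := by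
          rw [integral_const_mul, integral_add iIγ (integrable_const _)]
          simp
      _ ≤ P * ((D * m) ^ γ + (c₀ * m) ^ γ) := by
          gcongr
          exact hind m hm1 hmn
      _ = _ := by
          rw [Real.mul_rpow hD.le hm0.le, Real.mul_rpow hc₀ hm0.le]
          ring
  have hspaced := hmom hT hF hC₀ hm1 hB (by positivity) (by nlinarith) hB0 (by positivity) hβ k hk
  have hblocks := integral_abs_sum_blocks_le hT hγ0.le hB k
  set S := ∫ x, |spacedSum m (fun x => iteratedSum v w m x - c) k (orbitSeq T x)| ^ γ ∂μ
  have hcr := hcross v w hv hw hv0 hw0 (2 * k) m n (by omega) h2km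
  set φ := (k : ℝ) ^ (1 - γ) + (k : ℝ) ^ (-(γ / 2)) with hφ
  have hφ0 : 0 ≤ φ := by positivity
  have hkγ : (k : ℝ) ≤ (k : ℝ) ^ γ := by
    simpa using Real.rpow_le_rpow_of_exponent_le hk1 hγ.le
  have hφk : φ ≤ 2 * (k : ℝ) ^ γ := by
    have h1 : (k : ℝ) ^ (1 - γ) ≤ (k : ℝ) ^ γ :=
      Real.rpow_le_rpow_of_exponent_le hk1 (by linarith)
    have h2 : (k : ℝ) ^ (-(γ / 2)) ≤ (k : ℝ) ^ γ :=
      Real.rpow_le_rpow_of_exponent_le hk1 (by linarith)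
    linarith
  have hS : S ≤ K * L * ((k : ℝ) ^ γ + φ * D ^ γ) * (n : ℝ) ^ γ := by
    have e1 : (k : ℝ) * (C₀ * (m : ℝ) ^ (-γ) * ((1 + 2 * γ) * (k * (2 * (m : ℝ) ^ 2)) ^ γ)) ≤
        C₀ * (1 + 2 * γ) * ((k : ℝ) ^ γ * (n : ℝ) ^ γ) := by
      have h1 : (m : ℝ) ^ (-γ) * (k * (2 * (m : ℝ) ^ 2)) ^ γ ≤ (n : ℝ) ^ γ := by
        rw [Real.rpow_neg hm0.le, ← Real.inv_rpow hm0.le,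
          ← Real.mul_rpow (by positivity) (by positivity)]
        refine Real.rpow_le_rpow (by positivity) (le_trans (le_of_eq ?_) h2km') hγ0.le
        field_simp
      calc _ = C₀ * (1 + 2 * γ) * (k * ((m : ℝ) ^ (-γ) * (k * (2 * (m : ℝ) ^ 2)) ^ γ)) := by ring
        _ ≤ _ := by gcongr
    have e2 : (k + (k : ℝ) ^ (γ / 2)) * (m : ℝ) ^ γ ≤ φ * (n : ℝ) ^ γ := by
      have h1 := natCast_rpow_le_of_mul_le hγ0.le hk hkm
      have h2 : φ = (k + (k : ℝ) ^ (γ / 2)) * (k : ℝ) ^ (-γ) := by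
        rw [add_mul, ← Real.rpow_add hk0, ← Real.rpow_one_add' hk0.le (by linarith), hφ]
        congr 2
        ring
      rw [h2, mul_assoc]
      gcongr
    have e3 : (k + (k : ℝ) ^ (γ / 2)) * (P * (D ^ γ + c₀ ^ γ) * (m : ℝ) ^ γ) ≤
        P * (D ^ γ + c₀ ^ γ) * (φ * (n : ℝ) ^ γ) := by
      calc _ = P * (D ^ γ + c₀ ^ γ) * ((k + (k : ℝ) ^ (γ / 2)) * (m : ℝ) ^ γ) := by ring
        _ ≤ _ := by gcongr
    have e4 : P * c₀ ^ γ * (φ * (n : ℝ) ^ γ) ≤ P * c₀ ^ γ * (2 * (k : ℝ) ^ γ * (n : ℝ) ^ γ) := by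
      gcongr
    have e5 : 0 ≤ (C₀ * (1 + 2 * γ) + P * c₀ ^ γ * 2) * (φ * D ^ γ * (n : ℝ) ^ γ) := by positivity
    have e6 : 0 ≤ P * ((k : ℝ) ^ γ * (n : ℝ) ^ γ) := by positivity
    calc S ≤ _ := hspaced
      _ ≤ K * (L * ((k : ℝ) ^ γ + φ * D ^ γ) * (n : ℝ) ^ γ) := by
        refine mul_le_mul_of_nonneg_left ?_ hK.le
        rw [hL]
        linarith
      _ = _ := by ring
  set a : M → ℝ := fun x =>
    ∑ j ∈ Finset.range (2 * k), (iteratedSum v w m (orbitSeq T (T^[j * m] x)) - c) with ha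
  set b : M → ℝ := fun x => ∑ j ∈ Finset.range (2 * k),
    seqSum v (j * m) (orbitSeq T x) * seqSum w m (orbitSeq T (T^[j * m] x)) with hb
  have hdec : ∀ x, iteratedSum v w n (orbitSeq T x) = a x + (b x + (2 * k * c +
      iteratedSum v w r (orbitSeq T (T^[2 * k * m] x)) +
      seqSum v (2 * k * m) (orbitSeq T x) * seqSum w r (orbitSeq T (T^[2 * k * m] x)))) := by
    intro x
    conv_lhs => rw [← hnm]
    rw [iteratedSum_add_orbitSeq, iteratedSum_mul_orbitSeq, ha, hb]
    simp only [Finset.sum_sub_distrib, Finset.sum_const, Finset.card_range, nsmul_eq_mul]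
    push_cast
    ring
  have hrem : ∀ x, |2 * k * c + iteratedSum v w r (orbitSeq T (T^[2 * k * m] x)) +
      seqSum v (2 * k * m) (orbitSeq T x) * seqSum w r (orbitSeq T (T^[2 * k * m] x))| ≤
      (c₀ + 4) * k * n := by
    intro x
    have h1 : |2 * k * c| ≤ c₀ * k * n := by
      rw [abs_mul, abs_of_nonneg (by positivity)]
      calc 2 * (k : ℝ) * |c| ≤ 2 * k * (c₀ * m) := by gcongr
        _ = c₀ * (2 * k * m) := by ring
        _ ≤ c₀ * n := by gcongr
        _ ≤ c₀ * k * n := by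
          refine mul_le_mul_of_nonneg_right ?_ hn0.le
          exact le_mul_of_one_le_right hc₀ hk1
    have h2 : |iteratedSum v w r (orbitSeq T (T^[2 * k * m] x))| ≤ 2 * k * n := by
      refine (abs_iteratedSum_le hv hw r _).trans ?_
      rw [sq]
      gcongr
    have h3 : |seqSum v (2 * k * m) (orbitSeq T x) *
        seqSum w r (orbitSeq T (T^[2 * k * m] x))| ≤ n * (2 * k) := by
      rw [abs_mul]
      have h4 := hv.abs_seqSum_le (2 * k * m) (orbitSeq T x)
      push_cast at h4
      exact mul_le_mul (h4.trans h2km') ((hw.abs_seqSum_le r _).trans hrk) (abs_nonneg _) hn0.le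
    refine (abs_add_le _ _).trans ?_
    have h5 := abs_add_le (2 * k * c) (iteratedSum v w r (orbitSeq T (T^[2 * k * m] x)))
    linarith
  have mS : ∀ {u : M → ℝ}, IsUnitHolder η u → ∀ i s : ℕ,
      Measurable fun x => seqSum u i (orbitSeq T (T^[s] x)) := fun hu i s =>
    ((hu.isHolderFunctional_seqSum i).measurable.comp (measurable_orbitSeq hT.measurable)).comp
      (hT.iterate s).measurable
  have ia : Integrable (fun x => |a x| ^ γ) μ := by
    refine integrable_abs_rpow (Q := ∑ j ∈ Finset.range (2 * k), 2 * (m : ℝ) ^ 2)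
      (Finset.measurable_sum _ fun j _ => (mI m (j * m)).sub_const c) (fun x => ?_) hγ0.le
    exact (Finset.abs_sum_le_sum_abs _ _).trans (Finset.sum_le_sum fun j _ => hB.bound _)
  have ib : Integrable (fun x => |b x| ^ γ) μ := by
    refine integrable_abs_rpow (Q := ∑ j ∈ Finset.range (2 * k), ((j * m : ℕ) : ℝ) * m)
      (Finset.measurable_sum _ fun j _ => (mS hv (j * m) 0).mul (mS hw m (j * m)))
      (fun x => ?_) hγ0.le
    refine (Finset.abs_sum_le_sum_abs _ _).trans (Finset.sum_le_sum fun j _ => ?_)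
    rw [abs_mul]
    exact mul_le_mul (hv.abs_seqSum_le _ _) (hw.abs_seqSum_le _ _) (abs_nonneg _) (by positivity)
  have ir : Integrable (fun _ : M => ((c₀ + 4) * k * n) ^ γ) μ := integrable_const _
  have ibr : Integrable (fun x => P * (|b x| ^ γ + ((c₀ + 4) * k * n) ^ γ)) μ :=
    (ib.add ir).const_mul _
  calc ∫ x, |iteratedSum v w n (orbitSeq T x)| ^ γ ∂μ
      ≤ ∫ x, P * (|a x| ^ γ + P * (|b x| ^ γ + ((c₀ + 4) * k * n) ^ γ)) ∂μ := by
        refine integral_mono_of_nonneg (ae_of_all _ fun x => by positivity)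
          ((ia.add ibr).const_mul _) (ae_of_all _ fun x => ?_)
        simp only [hdec]
        refine (abs_add_rpow_le_two_rpow_mul hγ0.le _ _).trans ?_
        gcongr
        refine (abs_add_rpow_le_two_rpow_mul hγ0.le _ _).trans ?_
        gcongr
        exact hrem x
    _ = P * ((∫ x, |a x| ^ γ ∂μ) + P * ((∫ x, |b x| ^ γ ∂μ) + ((c₀ + 4) * k * n) ^ γ)) := by
        rw [integral_const_mul, integral_add ia ibr, integral_const_mul,
          integral_add ib ir]
        simp
    _ ≤ P * (P * (2 * (K * L * ((k : ℝ) ^ γ + φ * D ^ γ) * (n : ℝ) ^ γ)) +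
          P * (Cx * (P * (k : ℝ) ^ γ) * (n : ℝ) ^ γ +
            (c₀ + 4) ^ γ * (k : ℝ) ^ γ * (n : ℝ) ^ γ)) := by
        rw [Real.mul_rpow (by positivity) hn0.le, Real.mul_rpow (by positivity) hk0.le]
        push_cast at hcr
        rw [Real.mul_rpow zero_le_two hk0.le] at hcr
        gcongr
        refine hblocks.trans ?_
        gcongr
    _ ≤ _ := by
        have h1 : 0 ≤ P * (P * (Cx * P + (c₀ + 4) ^ γ)) * (φ * D ^ γ * (n : ℝ) ^ γ) := by
          positivity
        linarith

end Recursion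

theorem eLpNorm_rpow_eq_ofReal_integral {M : Type*} [MeasurableSpace M] {μ : Measure M}
    [IsProbabilityMeasure μ] {f : M → ℝ} {Q γ : ℝ} (hf : Measurable f) (hQ : ∀ x, |f x| ≤ Q)
    (hγ : 0 < γ) :
    eLpNorm f (ENNReal.ofReal γ) μ ^ γ = ENNReal.ofReal (∫ x, |f x| ^ γ ∂μ) := by
  have hI : 0 ≤ ∫ x, |f x| ^ γ ∂μ := integral_nonneg fun x => by positivity
  have hL : MemLp f (ENNReal.ofReal γ) μ :=
    MemLp.of_bound hf.aestronglyMeasurable Q (ae_of_all _ hQ)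
  rw [hL.eLpNorm_eq_integral_rpow_norm (by simpa using hγ) ENNReal.ofReal_ne_top,
    ENNReal.toReal_ofReal hγ.le]
  simp only [Real.norm_eq_abs]
  rw [ENNReal.ofReal_rpow_of_nonneg (by positivity) hγ.le, ← Real.rpow_mul hI,
    inv_mul_cancel₀ hγ.ne', Real.rpow_one]

theorem continuous_of_abs_sub_le_mul_dist_rpow {M : Type*} [MetricSpace M] {η : ℝ} (hη : 0 < η)
    {v : M → ℝ} {H : ℝ} (hv : ∀ x y, |v x - v y| ≤ H * dist x y ^ η) : Continuous v := by
  refine continuous_iff_continuousAt.2 fun x => tendsto_iff_dist_tendsto_zero.2 ?_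
  refine squeeze_zero (fun _ => dist_nonneg) (fun y => hv y x) ?_
  have h : Continuous fun y => H * dist y x ^ η :=
    ((continuous_id.dist continuous_const).rpow_const fun _ => Or.inr hη.le).const_mul H
  simpa [Real.zero_rpow hη.ne'] using h.tendsto x

theorem isUnitHolder_div {M : Type*} [MetricSpace M] [MeasurableSpace M] [BorelSpace M]
    {η : ℝ} (hη : 0 < η) {v : M → ℝ} {Vinf Vh : ℝ} (h0 : 0 ≤ Vinf) (h1 : 0 ≤ Vh)
    (hV : 0 < Vinf + Vh)
    (hb : ∀ x, |v x| ≤ Vinf)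
    (hh : ∀ x y, |v x - v y| ≤ Vh * dist x y ^ η) :
    IsUnitHolder η fun x => v x / (Vinf + Vh) where
  measurable := (continuous_of_abs_sub_le_mul_dist_rpow hη hh).measurable.div_const _
  bound x := by
    rw [abs_div, abs_of_pos hV, div_le_one hV]
    linarith [hb x]
  holder x y := by
    rw [← sub_div, abs_div, abs_of_pos hV, div_le_iff₀ hV]
    have h2 : 0 ≤ Vinf * dist x y ^ η := by positivity
    linarith [hh x y]

theorem iteratedSum_div {M : Type*} (v w : M → ℝ) (V W : ℝ) (m : ℕ) (x : ℕ → M) :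
    iteratedSum (fun x => v x / V) (fun x => w x / W) m x = iteratedSum v w m x / (V * W) := by
  simp only [iteratedSum, Finset.sum_div, div_mul_div_comm]

/-- **Claim in the proof of Theorem 2.5(b).** There is `C > 0` such that for all bounded
`η`-Hölder mean-zero `v, w`, every `D > 0`, every `k ≥ 1` and every `n ≥ 2k` such that the
inductive bound `‖𝕊_{v,w}(m)‖_{L^γ} ≤ D m ‖v‖_η ‖w‖_η` holds for all `1 ≤ m < n`, one has
`‖𝕊_{v,w}(n)‖_{L^γ}^γ ≤ C (k^γ + (k^{1-γ} + k^{-γ/2}) D^γ) (n ‖v‖_η ‖w‖_η)^γ`. -/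
theorem stmt12 {M : Type*} [MetricSpace M] [MeasurableSpace M] [BorelSpace M]
    (μ : Measure M) [IsProbabilityMeasure μ] (T : M → M) (hT : MeasurePreserving T μ μ)
    (η : ℝ) (hη0 : 0 < η) (hη1 : η ≤ 1) (γ : ℝ) (hγ : 1 < γ)
    (hFCB : FunctionalCorrelationBound μ T η γ) :
    ∃ C : ℝ, 0 < C ∧
      ∀ (v w : M → ℝ) (Vinf Vh Winf Wh : ℝ),
        0 ≤ Vinf → 0 ≤ Vh → 0 ≤ Winf → 0 ≤ Wh →
        (∀ x, |v x| ≤ Vinf) → (∀ x y, |v x - v y| ≤ Vh * dist x y ^ η) →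
        (∀ x, |w x| ≤ Winf) → (∀ x y, |w x - w y| ≤ Wh * dist x y ^ η) →
        (∫ x, v x ∂μ) = 0 → (∫ x, w x ∂μ) = 0 →
      ∀ (D : ℝ), 0 < D → ∀ (k : ℕ), 1 ≤ k → ∀ (n : ℕ), 2 * k ≤ n →
        (∀ m : ℕ, 1 ≤ m → m < n →
          eLpNorm (fun x => ∑ j ∈ Finset.range m, ∑ i ∈ Finset.range j,
              v (T^[i] x) * w (T^[j] x)) (ENNReal.ofReal γ) μ
            ≤ ENNReal.ofReal (D * (m : ℝ) * (Vinf + Vh) * (Winf + Wh))) →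
        eLpNorm (fun x => ∑ j ∈ Finset.range n, ∑ i ∈ Finset.range j,
            v (T^[i] x) * w (T^[j] x)) (ENNReal.ofReal γ) μ ^ γ
          ≤ ENNReal.ofReal (C * ((k : ℝ) ^ γ +
              ((k : ℝ) ^ (1 - γ) + (k : ℝ) ^ (-(γ / 2))) * D ^ γ) *
              ((n : ℝ) * (Vinf + Vh) * (Winf + Wh)) ^ γ) := by
  have hγ0 : 0 < γ := by linarith
  obtain ⟨C, hC, hmain⟩ := exists_integral_abs_iteratedSum_rpow_le hγ hT hFCB
  refine ⟨C, hC, fun v w Vinf Vh Winf Wh hVi hVh hWi hWh hvb hvh hwb hwh hv0 hw0 D hD k hk n hn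
    hind => ?_⟩
  change eLpNorm (fun x => iteratedSum v w n (orbitSeq T x)) (ENNReal.ofReal γ) μ ^ γ ≤ _
  change ∀ m : ℕ, 1 ≤ m → m < n →
    eLpNorm (fun x => iteratedSum v w m (orbitSeq T x)) (ENNReal.ofReal γ) μ ≤ _ at hind
  rcases (add_nonneg hVi hVh).eq_or_lt with hV | hV
  · have hv : ∀ x, v x = 0 := fun x => abs_nonpos_iff.1 ((hvb x).trans (by linarith))
    simp [iteratedSum, hv, ENNReal.zero_rpow_of_pos hγ0]
  rcases (add_nonneg hWi hWh).eq_or_lt with hW | hW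
  · have hw : ∀ x, w x = 0 := fun x => abs_nonpos_iff.1 ((hwb x).trans (by linarith))
    simp [iteratedSum, hw, ENNReal.zero_rpow_of_pos hγ0]
  have hv := isUnitHolder_div hη0 hVi hVh hV hvb hvh
  have hw := isUnitHolder_div hη0 hWi hWh hW hwb hwh
  set V := Vinf + Vh
  set W := Winf + Wh
  have hVW : 0 < V * W := mul_pos hV hW
  have hnorm : ∀ m, eLpNorm (fun x => iteratedSum v w m (orbitSeq T x)) (ENNReal.ofReal γ) μ ^ γ =
      ENNReal.ofReal ((∫ x, |iteratedSum (fun x => v x / V) (fun x => w x / W) m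
        (orbitSeq T x)| ^ γ ∂μ) * (V * W) ^ γ) := by
    intro m
    have e : ∀ x : ℕ → M, iteratedSum v w m x =
        iteratedSum (fun x => v x / V) (fun x => w x / W) m x * (V * W) := fun x => by
      rw [iteratedSum_div, div_mul_cancel₀ _ hVW.ne']
    have mI : Measurable fun x =>
        iteratedSum (fun x => v x / V) (fun x => w x / W) m (orbitSeq T x) :=
      (measurable_iteratedSum hv.measurable hw.measurable m).comp
        (measurable_orbitSeq hT.measurable)
    simp only [e]
    rw [eLpNorm_rpow_eq_ofReal_integral (Q := (m : ℝ) ^ 2 * (V * W)) (mI.mul_const _) _ hγ0,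
      ← integral_mul_const]
    · simp only [abs_mul _ (V * W), abs_of_pos hVW, Real.mul_rpow (abs_nonneg _) hVW.le]
    · intro x
      rw [abs_mul, abs_of_pos hVW]
      exact mul_le_mul_of_nonneg_right (abs_iteratedSum_le hv hw m _) hVW.le
  have hpow : ∀ t : ℝ, 0 ≤ t → (t * V * W) ^ γ = t ^ γ * (V * W) ^ γ := fun t ht => by
    rw [mul_assoc, Real.mul_rpow ht hVW.le]
  have hVWγ : 0 < (V * W) ^ γ := by positivity
  rw [hnorm, hpow _ n.cast_nonneg, ← mul_assoc]
  refine ENNReal.ofReal_le_ofReal (mul_le_mul_of_nonneg_right ?_ hVWγ.le)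
  refine hmain _ _ hv hw (by rw [integral_div, hv0, zero_div]) (by rw [integral_div, hw0, zero_div])
    D hD k hk n hn fun m hm hmn => ?_
  have h := ENNReal.rpow_le_rpow (hind m hm hmn) hγ0.le
  rw [hnorm, ENNReal.ofReal_rpow_of_nonneg (by positivity) hγ0.le,
    ENNReal.ofReal_le_ofReal_iff (by positivity), hpow _ (by positivity)] at h
  exact le_of_mul_le_mul_right h hVWγ
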